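/- arXiv:1501.05112 — 5 statements merged into one kernel-verified Lean document; each statement's English description precedes it below -/
import Mathlib

section
/- Convergence of rescaled solutions to a solution of a system of ordinary differential inequalities: fix ρ₁ ∈ (0,R) and define, in similarity variables σ = −log(T*−t), θ = e^{σ/2}(ρ−ρ₁), the rescaled functions W(σ,θ) = (T*−t)^α u(t,ρ) and Z(σ,θ) = (T*−t)^β v(t,ρ) (defined for σ ≥ −log T* and −ρ₁e^{σ/2} < θ < (R−ρ₁)e^{σ/2}). Then: (i) for every sequence σ_j → ∞ there exists a subsequence (not relabeled) such that for each σ ∈ ℝ the limits φ(σ) = lim_{θ→∞} (lim_{j→∞} W(σ+σ_j,θ)) and ψ(σ) = lim_{θ→∞} (lim_{j→∞} Z(σ+σ_j,θ)) exist and are finite, where the limits in j are uniform for (σ,θ) in bounded subsets of ℝ × ℝ and the limits in θ are monotone nonincreasing; (ii) the functions φ, ψ so obtained are bounded, continuous and nonnegative on ℝ, and (φ,ψ) satisfies φ' + αφ ≥ c₁ψ^p and ψ' + βψ ≥ c₁φ^q in the sense of distributions on ℝ, i.e. for every nonnegative ξ ∈ C_c^∞(ℝ): ∫(−φξ' + αφξ)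 dσ ≥ c₁∫ψ^p ξ dσ and ∫(−ψξ' + βψξ) dσ ≥ c₁∫φ^q ξ dσ. -/
open Set Filter MeasureTheory


def SupAt (δ β N : ℝ) (f : ℝ → ℝ → ℝ) (t x : ℝ) : Prop :=
  ∃ ft : ℝ, HasDerivAt (fun s => f s x) ft t ∧ ∀ c1 c2 : ℝ,
    (∀ᶠ y in nhds x, f t x + c1 * (y - x) + c2 * (y - x) ^ 2 ≤ f t y) →
      N ≤ ft - 2 * δ * c2 + δ * β * |c1|

lemma SupAt.mono {δ β N β' N' : ℝ} {f : ℝ → ℝ → ℝ} {t x : ℝ} (h : SupAt δ β N f t x)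
    (hδ : 0 ≤ δ) (hβ : β ≤ β') (hN : N' ≤ N) : SupAt δ β' N' f t x := by
  obtain ⟨ft, h1, h2⟩ := h
  refine ⟨ft, h1, fun c1 c2 hc => ?_⟩
  have := h2 c1 c2 hc
  have h3 : δ * β * |c1| ≤ δ * β' * |c1| := by gcongr
  linarith

lemma second_deriv_nonneg_of_min {g : ℝ → ℝ} {x : ℝ} (hg : IsLocalMin g x)
    (hc : ContinuousAt g x) : 0 ≤ deriv (deriv g) x := by
  by_contra hneg
  push Not at hneg
  have h1 : IsLocalMin (fun y => - g y) x := by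
    apply isLocalMin_of_deriv_deriv_pos
    · have : deriv (fun y => - g y) = fun y => - deriv g y := by
        funext y; exact deriv.fun_neg
      rw [this, deriv.fun_neg]; linarith
    · rw [deriv.fun_neg, hg.deriv_eq_zero, neg_zero]
    · exact hc.neg
  have h2 : g =ᶠ[nhds x] fun _ => g x := by
    filter_upwards [hg, h1] with y hy1 hy2
    linarith
  have h3 : deriv g =ᶠ[nhds x] fun _ => 0 := by
    have := h2.deriv
    simpa using this
  have h4 := h3.deriv_eq
  simp at h4
  linarith

lemma supAt_of_pde {δ β N b a c : ℝ} {f : ℝ → ℝ → ℝ} {t x : ℝ} (hδ : 0 ≤ δ)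
    (hf : ContDiffOn ℝ 2 (f t) (Ioo a c)) (hx : x ∈ Ioo a c)
    (hd : DifferentiableAt ℝ (fun s => f s x) t) (hb : |b| ≤ β)
    (hpde : N ≤ deriv (fun s => f s x) t - δ * (deriv (deriv (f t)) x + b * deriv (f t) x)) :
    SupAt δ β N f t x := by
  refine ⟨_, hd.hasDerivAt, fun c1 c2 hc => ?_⟩
  have hnb : Ioo a c ∈ nhds x := isOpen_Ioo.mem_nhds hx
  have hca : ContDiffAt ℝ 2 (f t) x := hf.contDiffAt hnb
  have hdiff : ∀ᶠ y in nhds x, DifferentiableAt ℝ (f t) y := by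
    filter_upwards [hnb] with y hy
    exact (hf.contDiffAt (isOpen_Ioo.mem_nhds hy)).differentiableAt (by norm_num)
  have hdd : DifferentiableAt ℝ (deriv (f t)) x := by
    have h2 : ContDiffOn ℝ 1 (deriv (f t)) (Ioo a c) :=
      hf.deriv_of_isOpen isOpen_Ioo (by norm_num)
    exact (h2.contDiffAt hnb).differentiableAt (by norm_num)
  set P : ℝ → ℝ := fun y => c1 * (y - x) + c2 * (y - x) ^ 2 with hP
  have hPd : ∀ y, HasDerivAt P (c1 + c2 * (2 * (y - x))) y := by
    intro y
    have h1 : HasDerivAt (fun y : ℝ => y - x) 1 y := (hasDerivAt_id y).sub_const x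
    have := (h1.const_mul c1).add ((h1.pow 2).const_mul c2)
    refine this.congr_deriv ?_
    norm_num
  have hmin : IsLocalMin (fun y => f t y - P y) x := by
    filter_upwards [hc] with y hy
    simp only [hP]
    simp
    linarith
  have hcont : ContinuousAt (fun y => f t y - P y) x :=
    hca.continuousAt.sub (hPd x).continuousAt
  have hder : deriv (fun y => f t y - P y) =ᶠ[nhds x]
      fun y => deriv (f t) y - (c1 + c2 * (2 * (y - x))) := by
    filter_upwards [hdiff] with y hy
    exact (hy.hasDerivAt.sub (hPd y)).deriv
  have h1 : deriv (f t) x = c1 := by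
    have := hmin.deriv_eq_zero
    rw [hder.eq_of_nhds] at this
    simp at this
    linarith
  have h2 : 2 * c2 ≤ deriv (deriv (f t)) x := by
    have := second_deriv_nonneg_of_min hmin hcont
    rw [hder.deriv_eq] at this
    have h3 : HasDerivAt (fun y => deriv (f t) y - (c1 + c2 * (2 * (y - x))))
        (deriv (deriv (f t)) x - (c2 * (2 * 1))) x := by
      have h1 : HasDerivAt (fun y : ℝ => y - x) 1 x := (hasDerivAt_id x).sub_const x
      exact hdd.hasDerivAt.sub (((h1.const_mul 2).const_mul c2).const_add c1)
    rw [h3.deriv] at this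
    linarith
  rw [h1] at hpde
  have h3 : δ * (2 * c2) ≤ δ * deriv (deriv (f t)) x := by gcongr
  have h4 : -(b * c1) ≤ β * |c1| := by
    have : -(b * c1) ≤ |b * c1| := neg_le_abs _
    rw [abs_mul] at this
    have : |b| * |c1| ≤ β * |c1| := by gcongr
    linarith
  have h5 : δ * (-(b * c1)) ≤ δ * (β * |c1|) := by gcongr
  nlinarith

lemma deriv_nonpos_of_left_min {g : ℝ → ℝ} {g' a t : ℝ} (h : HasDerivAt g g' t) (hat : a < t)
    (hm : ∀ s ∈ Icc a t, g t ≤ g s) : g' ≤ 0 := by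
  have h1 := (hasDerivWithinAt_iff_tendsto_slope' (s := Iio t) (x := t) (by simp)).1
    (h.hasDerivWithinAt (s := Iio t))
  refine le_of_tendsto h1 ?_
  filter_upwards [Ioo_mem_nhdsLT hat] with s hs
  rw [slope_def_field]
  apply div_nonpos_of_nonneg_of_nonpos
  · have := hm s ⟨hs.1.le, hs.2.le⟩; linarith
  · linarith [hs.2]

/-- lower barrier -/
lemma barrier {δ β N A B D t0 t1 x0 d : ℝ} {f : ℝ → ℝ → ℝ} (hδ : 0 ≤ δ) (hβ : 0 ≤ β)
    (hd : 0 ≤ d) (hD : 0 ≤ D)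
    (hc : ContinuousOn (Function.uncurry f) (Icc t0 t1 ×ˢ Icc (x0 - d) (x0 + d)))
    (hs : ∀ t ∈ Ioc t0 t1, ∀ x ∈ Ioo (x0 - d) (x0 + d), SupAt δ β N f t x)
    (hi : ∀ x ∈ Icc (x0 - d) (x0 + d), A - D * (x - x0) ^ 2 ≤ f t0 x)
    (hl : ∀ t ∈ Icc t0 t1, ∀ x ∈ Icc (x0 - d) (x0 + d), (x - x0) ^ 2 = d ^ 2 →
      A + B * (t - t0) - D * d ^ 2 ≤ f t x)
    (hN : B + 2 * δ * D * (1 + β * d) < N) :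
    ∀ t ∈ Icc t0 t1, ∀ x ∈ Icc (x0 - d) (x0 + d),
      A + B * (t - t0) - D * (x - x0) ^ 2 ≤ f t x := by
  intro t ht x hx
  by_contra hlt
  push Not at hlt
  set K := Icc t0 t1 ×ˢ Icc (x0 - d) (x0 + d) with hK
  set g : ℝ × ℝ → ℝ := fun z => Function.uncurry f z -
    (A + B * (z.1 - t0) - D * (z.2 - x0) ^ 2) with hg
  have hgc : ContinuousOn g K := hc.sub (by fun_prop)
  obtain ⟨⟨s, y⟩, hz, hmin⟩ := (isCompact_Icc.prod isCompact_Icc).exists_isMinOn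
    (s := K) ⟨(t, x), ht, hx⟩ hgc
  have hneg : g (s, y) < 0 := lt_of_le_of_lt (hmin (show (t, x) ∈ K from ⟨ht, hx⟩)) (by
    simp only [hg, Function.uncurry]; linarith)
  obtain ⟨hsI, hyI⟩ := hz
  simp only [] at hsI hyI
  simp only [hg, Function.uncurry] at hneg
  have hs0 : t0 < s := by
    rcases hsI.1.lt_or_eq with h | h
    · exact h
    · exfalso; have := hi y hyI; rw [← h] at hneg; simp at hneg; linarith
  have hyne : (y - x0) ^ 2 ≠ d ^ 2 := by
    intro h
    have := hl s hsI y hyI h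
    rw [h] at hneg; linarith
  have hy1 : x0 - d < y := by
    rcases hyI.1.lt_or_eq with h | h
    · exact h
    · exfalso; apply hyne; rw [← h]; ring
  have hy2 : y < x0 + d := by
    rcases hyI.2.lt_or_eq with h | h
    · exact h
    · exfalso; apply hyne; rw [h]; ring
  obtain ⟨ft, hft, hh⟩ := hs s ⟨hs0, hsI.2⟩ y ⟨hy1, hy2⟩
  have hft' : ft - B ≤ 0 := by
    have h1 : HasDerivAt (fun r => f r y - B * (r - s)) (ft - B * 1) s :=
      hft.sub (((hasDerivAt_id s).sub_const s).const_mul B)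
    have := deriv_nonpos_of_left_min h1 hs0 (fun r hr => by
      have := hmin (show (r, y) ∈ K from ⟨⟨hr.1, hr.2.trans hsI.2⟩, hyI⟩)
      simp only [hg, Function.uncurry, mem_ofPred_eq] at this
      simp only [sub_self, mul_zero, sub_zero]
      nlinarith)
    linarith
  have h2 := hh (-2 * D * (y - x0)) (-D) (by
    filter_upwards [Ioo_mem_nhds hy1 hy2] with r hr
    have := hmin (show (s, r) ∈ K from ⟨hsI, ⟨hr.1.le, hr.2.le⟩⟩)
    simp only [hg, Function.uncurry, mem_ofPred_eq] at this
    nlinarith)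
  have h3 : |-2 * D * (y - x0)| ≤ 2 * D * d := by
    rw [abs_mul]
    have : |y - x0| ≤ d := abs_le.2 ⟨by linarith, by linarith⟩
    have h4 : |-2 * D| = 2 * D := by rw [abs_mul, abs_of_nonneg hD]; norm_num
    rw [h4]; gcongr
  have h5 : δ * β * |-2 * D * (y - x0)| ≤ δ * β * (2 * D * d) := by gcongr
  nlinarith

set_option maxHeartbeats 2000000 in
/-- Lipschitz estimate -/
lemma lip_est {δ β N M K τ t1 x0 : ℝ} {f : ℝ → ℝ → ℝ} (hδ : 0 < δ) (hβ : 0 ≤ β) (hβ' : β ≤ 1 / 4)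
    (hτ : 0 < τ) (hM : 0 ≤ M) (hKM : M ≤ K) (hK : 2 * N + M / τ + 3 * δ * M < 3 * δ * K)
    (hc : ContinuousOn (Function.uncurry f) (Icc (t1 - τ) t1 ×ˢ Icc (x0 - 2) (x0 + 1)))
    (h0 : ∀ t ∈ Icc (t1 - τ) t1, ∀ x ∈ Icc (x0 - 2) (x0 + 1), 0 ≤ f t x ∧ f t x ≤ M)
    (hs : ∀ t ∈ Ioc (t1 - τ) t1, ∀ x ∈ Ioo (x0 - 2) (x0 + 1), SupAt δ β (-N) f t x)
    (hs' : ∀ t ∈ Ioc (t1 - τ) t1, ∀ x ∈ Ioo (x0 - 2) (x0 + 1),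
      SupAt δ β (-N) (fun t x => - f t x) t x) :
    ∀ y ∈ Icc (x0 - 1) x0, f t1 y - f t1 x0 ≤ 2 * K * (x0 - y) := by
  intro y0 hy0
  by_contra hlt
  push Not at hlt
  -- variables: (t, x, s), y = x - s
  set C : Set (ℝ × ℝ × ℝ) := Icc (t1 - τ) t1 ×ˢ Icc (x0 - 1) (x0 + 1) ×ˢ Icc 0 1 with hC
  set g : ℝ × ℝ × ℝ → ℝ := fun z => Function.uncurry f (z.1, z.2.1 - z.2.2) -
    Function.uncurry f (z.1, z.2.1) - (K * (2 * z.2.2 - z.2.2 ^ 2) +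
      M * ((z.2.1 - x0) ^ 2 + (t1 - z.1) / τ)) with hg
  have hgc : ContinuousOn g C := by
    refine ((hc.comp (by fun_prop) ?_).sub (hc.comp (by fun_prop) ?_)).sub (by fun_prop)
    · rintro ⟨t, x, s⟩ ⟨h1, h2, h3⟩
      simp only [mem_Icc] at h1 h2 h3
      simp only [mem_prod, mem_Icc]
      exact ⟨h1, by linarith, by linarith⟩
    · rintro ⟨t, x, s⟩ ⟨h1, h2, h3⟩
      simp only [mem_Icc] at h1 h2 h3
      simp only [mem_prod, mem_Icc]
      exact ⟨h1, by linarith, by linarith⟩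
  have hmem : (t1, x0, x0 - y0) ∈ C := by
    simp only [hC, mem_prod, mem_Icc]
    refine ⟨⟨by linarith, le_rfl⟩, ⟨by linarith, by linarith⟩, ⟨by linarith [hy0.2], by linarith [hy0.1]⟩⟩
  obtain ⟨⟨t, x, s⟩, ⟨ht, hx, hsI⟩, hmax⟩ := (isCompact_Icc.prod (isCompact_Icc.prod isCompact_Icc)).exists_isMaxOn
    (s := C) ⟨_, hmem⟩ hgc
  have hpos : 0 < g (t, x, s) := by
    refine lt_of_lt_of_le ?_ (hmax hmem)
    simp only [hg, Function.uncurry]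
    have : K * (x0 - y0) ^ 2 ≥ 0 := mul_nonneg (by linarith) (sq_nonneg _)
    have e : x0 - (x0 - y0) = y0 := by ring
    rw [e]
    simp
    nlinarith
  simp only [] at ht hx hsI
  simp only [hg, Function.uncurry] at hpos
  have hK0 : 0 ≤ K := by linarith
  have ha := h0 t ht (x - s) ⟨by linarith [hx.1, hsI.2], by linarith [hx.2, hsI.1]⟩
  have hb := h0 t ht x ⟨by linarith [hx.1, hsI.2], by linarith [hx.2, hsI.1]⟩
  have hP1 : 0 ≤ K * (2 * s - s ^ 2) := mul_nonneg hK0 (by nlinarith [hsI.1, hsI.2])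
  have hP2 : 0 ≤ M * (x - x0) ^ 2 := by positivity
  have hP3 : 0 ≤ M * ((t1 - t) / τ) := mul_nonneg hM (div_nonneg (by linarith [ht.2]) hτ.le)
  have ht0 : t1 - τ < t := by
    rcases ht.1.lt_or_eq with h | h
    · exact h
    · exfalso
      have : (t1 - t) / τ = 1 := by rw [← h]; field_simp; ring
      rw [this] at hpos; linarith
  have hs1 : s < 1 := by
    rcases hsI.2.lt_or_eq with h | h
    · exact h
    · exfalso; rw [h] at hpos ha; linarith
  have hs0 : 0 < s := by
    rcases hsI.1.lt_or_eq with h | h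
    · exact h
    · exfalso; rw [← h] at hpos; simp at hpos; linarith
  have hxne : (x - x0) ^ 2 ≠ 1 := by
    intro h; rw [h] at hpos; linarith
  have hx1 : x0 - 1 < x := by
    rcases hx.1.lt_or_eq with h | h
    · exact h
    · exfalso; apply hxne; rw [← h]; ring
  have hx2 : x < x0 + 1 := by
    rcases hx.2.lt_or_eq with h | h
    · exact h
    · exfalso; apply hxne; rw [h]; ring
  obtain ⟨ft, hft, hh⟩ := hs t ⟨ht0, ht.2⟩ x ⟨by linarith, by linarith⟩
  obtain ⟨ft', hft', hh'⟩ := hs' t ⟨ht0, ht.2⟩ (x - s) ⟨by linarith, by linarith⟩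
  have hT : ft + ft' - M / τ ≤ 0 := by
    have h1 : HasDerivAt (fun r => f r x + (- f r (x - s)) - M / τ * (r - t))
        (ft + ft' - M / τ * 1) t :=
      (hft.add hft').sub (((hasDerivAt_id t).sub_const t).const_mul _)
    have := deriv_nonpos_of_left_min h1 ht0 (fun r hr => by
      have := hmax (show (r, x, s) ∈ C from ⟨⟨hr.1, hr.2.trans ht.2⟩, hx, hsI⟩)
      simp only [hg, Function.uncurry, mem_ofPred_eq] at this
      have e1 : M * ((t1 - r) / τ) = M * ((t1 - t) / τ) - M / τ * (r - t) := by field_simp; ring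
      simp only [sub_self, mul_zero, sub_zero]
      nlinarith)
    linarith
  have hA := hh (-(K * (2 - 2 * s) + 2 * M * (x - x0))) (K - M) (by
    have hev : ∀ᶠ r in nhds x, r ∈ Icc (x0 - 1) (x0 + 1) ∧ r - (x - s) ∈ Icc (0:ℝ) 1 := by
      filter_upwards [Ioo_mem_nhds hx1 hx2,
        Ioo_mem_nhds (show x - s < x by linarith) (show x < x - s + 1 by linarith)] with r h1 h2
      exact ⟨⟨h1.1.le, h1.2.le⟩, ⟨by linarith [h2.1], by linarith [h2.2]⟩⟩
    filter_upwards [hev] with r hr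
    have := hmax (show (t, r, r - (x - s)) ∈ C from ⟨ht, hr.1, hr.2⟩)
    simp only [hg, Function.uncurry, mem_ofPred_eq] at this
    rw [show r - (r - (x - s)) = x - s by ring] at this
    nlinarith)
  have hB := hh' (K * (2 - 2 * s)) K (by
    have hev : ∀ᶠ r in nhds (x - s), x - r ∈ Icc (0:ℝ) 1 := by
      filter_upwards [Ioo_mem_nhds (show x - 1 < x - s by linarith) (show x - s < x by linarith)]
        with r h2
      exact ⟨by linarith [h2.2], by linarith [h2.1]⟩
    filter_upwards [hev] with r hr
    have := hmax (show (t, x, x - r) ∈ C from ⟨ht, hx, hr⟩)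
    simp only [hg, Function.uncurry, mem_ofPred_eq] at this
    rw [show x - (x - r) = r by ring] at this
    nlinarith)
  have hK2 : |K * (2 - 2 * s)| ≤ 2 * K := by
    rw [abs_of_nonneg (mul_nonneg hK0 (by linarith))]
    nlinarith
  have hK1 : |-(K * (2 - 2 * s) + 2 * M * (x - x0))| ≤ 2 * K + 2 * M := by
    rw [abs_neg]
    refine (abs_add_le _ _).trans (add_le_add hK2 ?_)
    rw [abs_mul, abs_of_nonneg (by linarith : 0 ≤ 2 * M)]
    have : |x - x0| ≤ 1 := abs_le.2 ⟨by linarith, by linarith⟩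
    nlinarith
  have hβδ : δ * β ≤ δ * (1 / 4) := by gcongr
  have e1 : δ * β * |-(K * (2 - 2 * s) + 2 * M * (x - x0))| ≤ δ * (1 / 4) * (2 * K + 2 * M) := by
    gcongr
  have e2 : δ * β * |K * (2 - 2 * s)| ≤ δ * (1 / 4) * (2 * K) := by
    gcongr
  nlinarith


/-- time modulus from below -/
lemma time_low {δ β N M K η B t1 t2 x0 : ℝ} {f : ℝ → ℝ → ℝ} (hδ : 0 ≤ δ) (hβ : 0 ≤ β)
    (hη : 0 < η) (hM : 0 ≤ M) (hN : 0 ≤ N)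
    (hB : 2 * δ * (K ^ 2 / (4 * η) + M) * (1 + β) + N < B)
    (hc : ContinuousOn (Function.uncurry f) (Icc t1 t2 ×ˢ Icc (x0 - 1) (x0 + 1)))
    (hs : ∀ t ∈ Ioc t1 t2, ∀ x ∈ Ioo (x0 - 1) (x0 + 1), SupAt δ β (-N) f t x)
    (hb : ∀ t ∈ Icc t1 t2, ∀ x ∈ Icc (x0 - 1) (x0 + 1), f t1 x0 - M ≤ f t x)
    (hl : ∀ x ∈ Icc (x0 - 1) (x0 + 1), f t1 x0 - K * |x - x0| ≤ f t1 x) :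
    ∀ t ∈ Icc t1 t2, f t1 x0 - η - B * (t - t1) ≤ f t x0 := by
  intro t ht
  have hD : 0 ≤ K ^ 2 / (4 * η) + M := by positivity
  have hB0 : 0 ≤ B := by
    have : 0 ≤ 2 * δ * (K ^ 2 / (4 * η) + M) * (1 + β) + N := by positivity
    linarith
  have := barrier (A := f t1 x0 - η) (B := -B) (D := K ^ 2 / (4 * η) + M) (d := 1) hδ hβ zero_le_one hD
    hc hs (fun x hx => by
      have h1 := hl x hx
      have h2 : K * |x - x0| ≤ η + K ^ 2 / (4 * η) * (x - x0) ^ 2 := by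
        rw [← sq_abs (x - x0)]
        have : 0 ≤ (2 * η - K * |x - x0|) ^ 2 / (4 * η) := by positivity
        have e : (2 * η - K * |x - x0|) ^ 2 / (4 * η) = η - K * |x - x0| + K ^ 2 / (4 * η) * |x - x0| ^ 2 := by
          field_simp; ring
        linarith
      nlinarith [sq_nonneg (x - x0)])
    (fun t ht x hx _ => by
      have h1 := hb t ht x hx
      have : 0 ≤ K ^ 2 / (4 * η) := by positivity
      have : 0 ≤ B * (t - t1) := mul_nonneg hB0 (by linarith [ht.1])
      nlinarith) (by nlinarith) t ht x0 ⟨by linarith, by linarith⟩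
  simp at this
  linarith

/-- equicontinuity -/
lemma equi_est (δ M N τ η : ℝ) (hδ : 0 < δ) (hM : 0 ≤ M) (hN : 0 ≤ N) (hτ : 0 < τ) (hη : 0 < η) :
    ∃ r > 0, ∀ (β s y : ℝ) (f : ℝ → ℝ → ℝ), 0 ≤ β → β ≤ 1 / 4 →
      ContinuousOn (Function.uncurry f) (Icc (s - 2 * τ) (s + τ) ×ˢ Icc (y - 4) (y + 4)) →
      (∀ t ∈ Icc (s - 2 * τ) (s + τ), ∀ x ∈ Icc (y - 4) (y + 4), 0 ≤ f t x ∧ f t x ≤ M) →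
      (∀ t ∈ Icc (s - 2 * τ) (s + τ), AntitoneOn (f t) (Icc (y - 4) (y + 4))) →
      (∀ t ∈ Icc (s - 2 * τ) (s + τ), ∀ x ∈ Icc (y - 4) (y + 4),
        SupAt δ β (-N) f t x ∧ SupAt δ β (-N) (fun t x => - f t x) t x) →
      ∀ s' y', |s' - s| ≤ r → |y' - y| ≤ r → |f s' y' - f s y| ≤ η := by
  set K := M + (2 * N + M / τ + 1) / (3 * δ) with hKdef
  have hKM : M ≤ K := by
    have : 0 ≤ (2 * N + M / τ + 1) / (3 * δ) := by positivity
    linarith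
  have hK0 : 0 ≤ K := hM.trans hKM
  have hK : 2 * N + M / τ + 3 * δ * M < 3 * δ * K := by
    have : 3 * δ * K = 3 * δ * M + (2 * N + M / τ + 1) := by
      rw [hKdef]; field_simp
    linarith
  set B := 2 * δ * ((2 * K) ^ 2 / (4 * (η / 3)) + M) * (1 + 1 / 4) + N + 1 with hBdef
  have hB0 : 0 < B := by positivity
  refine ⟨min (min 1 τ) (min (η / 3 / (2 * K + 1)) (η / 3 / B)), by positivity, ?_⟩
  intro β s y f hβ hβ' hc h0 hanti hs s' y' hs' hy'
  have hr1 : |s' - s| ≤ τ := hs'.trans ((min_le_left _ _).trans (min_le_right _ _))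
  have hr2 : |y' - y| ≤ 1 := hy'.trans ((min_le_left _ _).trans (min_le_left _ _))
  have hr3 : |y' - y| ≤ η / 3 / (2 * K + 1) := hy'.trans ((min_le_right _ _).trans (min_le_left _ _))
  have hr4 : |s' - s| ≤ η / 3 / B := hs'.trans ((min_le_right _ _).trans (min_le_right _ _))
  -- Lipschitz bound
  have lip : ∀ t ∈ Icc (s - τ) (s + τ), ∀ a ∈ Icc (y - 1) (y + 1), ∀ b ∈ Icc (y - 1) (y + 1),
      a ≤ b → b - a ≤ 1 → f t a - f t b ≤ 2 * K * (b - a) := by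
    intro t ht a ha b hb hab hab1
    have hsub1 : Icc (t - τ) t ⊆ Icc (s - 2 * τ) (s + τ) :=
      Icc_subset_Icc (by linarith [ht.1]) ht.2
    have hsub2 : Icc (b - 2) (b + 1) ⊆ Icc (y - 4) (y + 4) :=
      Icc_subset_Icc (by linarith [hb.1]) (by linarith [hb.2])
    exact lip_est hδ hβ hβ' hτ hM hKM hK (hc.mono (prod_mono hsub1 hsub2))
      (fun t ht x hx => h0 t (hsub1 ht) x (hsub2 hx))
      (fun t ht x hx => (hs t (hsub1 (Ioc_subset_Icc_self ht)) x (hsub2 (Ioo_subset_Icc_self hx))).1)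
      (fun t ht x hx => (hs t (hsub1 (Ioc_subset_Icc_self ht)) x (hsub2 (Ioo_subset_Icc_self hx))).2)
      a ⟨by linarith, hab⟩
  have hy4 : y ∈ Icc (y - 4) (y + 4) := ⟨by linarith, by linarith⟩
  have lipabs : ∀ t ∈ Icc (s - τ) (s + τ), ∀ x ∈ Icc (y - 1) (y + 1),
      |f t x - f t y| ≤ 2 * K * |x - y| := by
    intro t ht x hx
    have ht' : t ∈ Icc (s - 2 * τ) (s + τ) := ⟨by linarith [ht.1], ht.2⟩
    have hx4 : x ∈ Icc (y - 4) (y + 4) := ⟨by linarith [hx.1], by linarith [hx.2]⟩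
    have hyy : y ∈ Icc (y - 1) (y + 1) := ⟨by linarith, by linarith⟩
    rcases le_total x y with h | h
    · have h1 := lip t ht x hx y hyy h (by linarith [hx.1])
      have h2 := hanti t ht' hx4 hy4 h
      rw [abs_of_nonneg (by linarith), abs_of_nonpos (by linarith)]; linarith
    · have h1 := lip t ht y hyy x hx h (by linarith [hx.2])
      have h2 := hanti t ht' hy4 hx4 h
      rw [abs_of_nonpos (by linarith), abs_of_nonneg (by linarith)]; linarith
  -- time bound
  have tim : ∀ a ∈ Icc (s - τ) (s + τ), ∀ b ∈ Icc (s - τ) (s + τ), a ≤ b →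
      |f b y - f a y| ≤ η / 3 + B * (b - a) := by
    intro a ha b hb hab
    have hsub1 : Icc a b ⊆ Icc (s - 2 * τ) (s + τ) :=
      Icc_subset_Icc (by linarith [ha.1]) hb.2
    have hsub2 : Icc (y - 1) (y + 1) ⊆ Icc (y - 4) (y + 4) :=
      Icc_subset_Icc (by linarith) (by linarith)
    have hBB : 2 * δ * ((2 * K) ^ 2 / (4 * (η / 3)) + M) * (1 + β) + N < B := by
      have : 2 * δ * ((2 * K) ^ 2 / (4 * (η / 3)) + M) * (1 + β) ≤
          2 * δ * ((2 * K) ^ 2 / (4 * (η / 3)) + M) * (1 + 1 / 4) := by gcongr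
      linarith
    have hca := hc.mono (prod_mono hsub1 hsub2)
    have h1 := time_low (f := f) hδ.le hβ (by positivity : 0 < η / 3) hM hN hBB hca
      (fun t ht x hx => (hs t (hsub1 (Ioc_subset_Icc_self ht)) x (hsub2 (Ioo_subset_Icc_self hx))).1)
      (fun t ht x hx => by
        have h1 := h0 t (hsub1 ht) x (hsub2 hx)
        have h2 := h0 a (hsub1 ⟨le_rfl, hab⟩) y hy4
        linarith)
      (fun x hx => by
        have := (abs_le.1 (lipabs a ha x hx)).1
        linarith) b ⟨hab, le_rfl⟩
    have h2 := time_low (f := fun t x => - f t x) hδ.le hβ (by positivity : 0 < η / 3) hM hN hBB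
      hca.neg
      (fun t ht x hx => (hs t (hsub1 (Ioc_subset_Icc_self ht)) x (hsub2 (Ioo_subset_Icc_self hx))).2)
      (fun t ht x hx => by
        have h1 := h0 t (hsub1 ht) x (hsub2 hx)
        have h2 := h0 a (hsub1 ⟨le_rfl, hab⟩) y hy4
        linarith)
      (fun x hx => by
        have := (abs_le.1 (lipabs a ha x hx)).2
        linarith) b ⟨hab, le_rfl⟩
    rw [abs_le]; constructor <;> linarith
  have hs'I : s' ∈ Icc (s - τ) (s + τ) := by
    have := abs_le.1 hr1; exact ⟨by linarith, by linarith⟩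
  have hsI : s ∈ Icc (s - τ) (s + τ) := ⟨by linarith, by linarith⟩
  have hy'I : y' ∈ Icc (y - 1) (y + 1) := by
    have := abs_le.1 hr2; exact ⟨by linarith, by linarith⟩
  have p1 : |f s' y' - f s' y| ≤ η / 3 := by
    refine (lipabs s' hs'I y' hy'I).trans ?_
    calc 2 * K * |y' - y| ≤ (2 * K + 1) * (η / 3 / (2 * K + 1)) := by gcongr; linarith
      _ = η / 3 := by field_simp
  have hB1 : B * |s' - s| ≤ η / 3 := by
    calc B * |s' - s| ≤ B * (η / 3 / B) := by gcongr
      _ = η / 3 := by field_simp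
  have p2 : |f s' y - f s y| ≤ η / 3 + η / 3 := by
    rcases le_total s s' with h | h
    · rw [abs_of_nonneg (by linarith)] at hB1
      linarith [tim s hsI s' hs'I h]
    · rw [abs_of_nonpos (by linarith)] at hB1
      rw [abs_sub_comm]
      linarith [tim s' hs'I s hsI h]
  have := abs_sub_le (f s' y') (f s' y) (f s y)
  linarith

/-- long interval barrier -/
lemma wide_barrier {δ β N M a D L t0 t1 x0 : ℝ} {f : ℝ → ℝ → ℝ} (hδ : 0 ≤ δ) (hβ : 0 ≤ β)
    (hL : 0 ≤ L) (hD : 0 ≤ D) (hβL : β * L ≤ 1) (ht : t0 ≤ t1)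
    (hDL : M + a + |N| * (t1 - t0) ≤ D * L ^ 2)
    (hc : ContinuousOn (Function.uncurry f) (Icc t0 t1 ×ˢ Icc (x0 - L) (x0 + L)))
    (hs : ∀ t ∈ Ioc t0 t1, ∀ x ∈ Ioo (x0 - L) (x0 + L), SupAt δ β N f t x)
    (hi : ∀ x ∈ Icc (x0 - L) (x0 + L), a ≤ f t0 x)
    (hl : ∀ t ∈ Icc t0 t1, ∀ x ∈ Icc (x0 - L) (x0 + L), -M ≤ f t x) :
    a + (N - 4 * δ * D) * (t1 - t0) ≤ f t1 x0 := by
  have key : ∀ ε > 0, a + (N - 4 * δ * D - ε) * (t1 - t0) ≤ f t1 x0 := by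
    intro ε hε
    have := barrier (A := a) (B := N - 4 * δ * D - ε) (D := D) hδ hβ hL hD hc hs
      (fun x hx => by have := hi x hx; nlinarith [sq_nonneg (x - x0)])
      (fun t ht x hx _ => by
        have h1 := hl t ht x hx
        have h2 : (N - 4 * δ * D - ε) * (t - t0) ≤ |N| * (t - t0) := by
          apply mul_le_mul_of_nonneg_right _ (by linarith [ht.1])
          have : 0 ≤ δ * D := by positivity
          linarith [le_abs_self N]
        have h3 : |N| * (t - t0) ≤ |N| * (t1 - t0) := by
          gcongr; exact ht.2
        linarith)
      (by
        have : 2 * δ * D * (β * L) ≤ 2 * δ * D * 1 := by gcongr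
        linarith) t1 ⟨ht, le_rfl⟩ x0 ⟨by linarith, by linarith⟩
    simpa using this
  have hlim : Tendsto (fun ε : ℝ => a + (N - 4 * δ * D - ε) * (t1 - t0)) (nhdsWithin 0 (Ioi 0))
      (nhds (a + (N - 4 * δ * D - 0) * (t1 - t0))) := by
    apply Tendsto.mono_left _ nhdsWithin_le_nhds
    exact Continuous.tendsto (by fun_prop) 0
  have := le_of_tendsto hlim (by filter_upwards [self_mem_nhdsWithin] with ε hε using key ε hε)
  simpa using this

lemma persist {δ β M h t0 x0 d : ℝ} {f : ℝ → ℝ → ℝ} (hδ : 0 ≤ δ) (hβ : 0 ≤ β)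
    (hM : 0 < M) (hh : 0 < h) (hd : 0 < d) (hdh : 8 * δ * (1 + β * d) * h < d ^ 2)
    (hc : ContinuousOn (Function.uncurry f) (Icc t0 (t0 + h) ×ˢ Icc (x0 - d) (x0 + d)))
    (hs : ∀ t ∈ Ioc t0 (t0 + h), ∀ x ∈ Ioo (x0 - d) (x0 + d), SupAt δ β 0 f t x)
    (hi : ∀ x ∈ Icc (x0 - d) (x0 + d), M ≤ f t0 x)
    (hl : ∀ t ∈ Icc t0 (t0 + h), ∀ x ∈ Icc (x0 - d) (x0 + d), 0 ≤ f t x) :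
    ∀ t ∈ Icc t0 (t0 + h), ∀ x ∈ Icc (x0 - d / 2) (x0 + d / 2), M / 2 ≤ f t x := by
  intro t ht x hx
  have hdd : M / d ^ 2 * d ^ 2 = M := by field_simp
  have := barrier (A := M) (B := -(M / (4 * h))) (D := M / d ^ 2) hδ hβ hd.le (by positivity) hc hs
    (fun x hx => by
      have := hi x hx
      have : 0 ≤ M / d ^ 2 * (x - x0) ^ 2 := by positivity
      linarith)
    (fun t ht x hx _ => by
      have := hl t ht x hx
      have : 0 ≤ M / (4 * h) * (t - t0) := mul_nonneg (by positivity) (by linarith [ht.1])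
      linarith)
    (by
      have e : M / (4 * h) - 2 * δ * (M / d ^ 2) * (1 + β * d) =
        M / (4 * h * d ^ 2) * (d ^ 2 - 8 * δ * (1 + β * d) * h) := by field_simp; ring
      have : 0 < M / (4 * h * d ^ 2) * (d ^ 2 - 8 * δ * (1 + β * d) * h) :=
        mul_pos (by positivity) (by linarith)
      linarith) t ht x ⟨by linarith [hx.1], by linarith [hx.2]⟩
  have h1 : M / (4 * h) * (t - t0) ≤ M / 4 := by
    calc M / (4 * h) * (t - t0) ≤ M / (4 * h) * h := by gcongr; linarith [ht.2]
      _ = M / 4 := by field_simp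
  have h2 : M / d ^ 2 * (x - x0) ^ 2 ≤ M / 4 := by
    have : (x - x0) ^ 2 ≤ (d / 2) ^ 2 := sq_le_sq' (by linarith [hx.1]) (by linarith [hx.2])
    calc M / d ^ 2 * (x - x0) ^ 2 ≤ M / d ^ 2 * (d / 2) ^ 2 := by gcongr
      _ = M / 4 := by field_simp; norm_num
  linarith

lemma growth {δ β N h t0 x0 d : ℝ} {f : ℝ → ℝ → ℝ} (hδ : 0 ≤ δ) (hβ : 0 ≤ β)
    (hN : 0 < N) (hh : 0 < h) (hd : 0 < d) (hdh : 4 * δ * (1 + β * d) * h < d ^ 2)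
    (hc : ContinuousOn (Function.uncurry f) (Icc t0 (t0 + h) ×ˢ Icc (x0 - d) (x0 + d)))
    (hs : ∀ t ∈ Ioc t0 (t0 + h), ∀ x ∈ Ioo (x0 - d) (x0 + d), SupAt δ β N f t x)
    (hl : ∀ t ∈ Icc t0 (t0 + h), ∀ x ∈ Icc (x0 - d) (x0 + d), 0 ≤ f t x) :
    ∀ t ∈ Icc (t0 + h / 2) (t0 + h), ∀ x ∈ Icc (x0 - d / 4) (x0 + d / 4), N * h / 8 ≤ f t x := by
  intro t ht x hx
  have hdd : N * h / d ^ 2 * d ^ 2 = N * h := by field_simp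
  have := barrier (A := 0) (B := N / 2) (D := N * h / d ^ 2) hδ hβ hd.le (by positivity) hc hs
    (fun x hx => by
      have := hl t0 ⟨le_rfl, by linarith⟩ x hx
      have : 0 ≤ N * h / d ^ 2 * (x - x0) ^ 2 := by positivity
      linarith)
    (fun t ht x hx _ => by
      have := hl t ht x hx
      have : N / 2 * (t - t0) ≤ N / 2 * h := by gcongr; linarith [ht.2]
      have : 0 < N * h := by positivity
      linarith)
    (by
      have e : N / 2 - 2 * δ * (N * h / d ^ 2) * (1 + β * d) =
        N / (2 * d ^ 2) * (d ^ 2 - 4 * δ * (1 + β * d) * h) := by field_simp; ring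
      have : 0 < N / (2 * d ^ 2) * (d ^ 2 - 4 * δ * (1 + β * d) * h) :=
        mul_pos (by positivity) (by linarith)
      linarith) t ⟨by linarith [ht.1], ht.2⟩ x ⟨by linarith [hx.1], by linarith [hx.2]⟩
  have h1 : N / 2 * (h / 2) ≤ N / 2 * (t - t0) := by gcongr; linarith [ht.1]
  have h2 : N * h / d ^ 2 * (x - x0) ^ 2 ≤ N * h / 16 := by
    have : (x - x0) ^ 2 ≤ (d / 4) ^ 2 := sq_le_sq' (by linarith [hx.1]) (by linarith [hx.2])
    calc N * h / d ^ 2 * (x - x0) ^ 2 ≤ N * h / d ^ 2 * (d / 4) ^ 2 := by gcongr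
      _ = N * h / 16 := by field_simp; norm_num
  have : 0 < N * h := by positivity
  linarith


lemma doubling {δ1 δ2 β p q c₁ T ta L0 c t0 M h d x0 : ℝ} {u v : ℝ → ℝ → ℝ}
    (hδ1 : 0 < δ1) (hδ2 : 0 < δ2) (hβ : 0 ≤ β) (hp : 1 < p) (hq : 1 < q) (hc₁ : 0 < c₁)
    (huc : ContinuousOn (Function.uncurry u) (Ico ta T ×ˢ Icc (c - L0) (c + L0)))
    (hvc : ContinuousOn (Function.uncurry v) (Ico ta T ×ˢ Icc (c - L0) (c + L0)))
    (hu0 : ∀ t ∈ Ico ta T, ∀ x ∈ Icc (c - L0) (c + L0), 0 ≤ u t x)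
    (hv0 : ∀ t ∈ Ico ta T, ∀ x ∈ Icc (c - L0) (c + L0), 0 ≤ v t x)
    (hus : ∀ t ∈ Ioo ta T, ∀ x ∈ Icc (c - L0) (c + L0), SupAt δ1 β (c₁ * v t x ^ p) u t x)
    (hvs : ∀ t ∈ Ioo ta T, ∀ x ∈ Icc (c - L0) (c + L0), SupAt δ2 β (c₁ * u t x ^ q) v t x)
    (hta : ta ≤ t0) (hM : 0 < M) (hh : 0 < h) (hd : 0 < d) (hT : t0 + h < T)
    (hx1 : c - L0 ≤ x0 - d) (hx2 : x0 + d ≤ c + L0)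
    (hdh : 200 * (δ1 + δ2) * (1 + β * L0) * h ≤ d ^ 2)
    (hi : ∀ x ∈ Icc (x0 - d) (x0 + d), M ≤ u t0 x) :
    c₁ * (c₁ * (M / 2) ^ q * h / 8) ^ p * h / 16 ≤ u (t0 + h) x0 := by
  have hdL : d ≤ L0 := by linarith
  have hL0 : 0 < L0 := by linarith
  have hd1 : 200 * δ1 * (1 + β * d) * h ≤ d ^ 2 := by
    refine le_trans ?_ hdh
    gcongr; linarith
  have hd2 : 200 * δ2 * (1 + β * d) * h ≤ d ^ 2 := by
    refine le_trans ?_ hdh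
    gcongr; linarith
  have hβd : 0 ≤ β * d := by positivity
  have hpos1 : 0 < δ1 * (1 + β * d) * h := by positivity
  have hpos2 : 0 < δ2 * (1 + β * d) * h := by positivity
  have st : Icc t0 (t0 + h) ⊆ Ico ta T := fun t ht => ⟨hta.trans ht.1, ht.2.trans_lt hT⟩
  have sx : Icc (x0 - d) (x0 + d) ⊆ Icc (c - L0) (c + L0) := Icc_subset_Icc hx1 hx2
  have k1 := persist (f := u) (t0 := t0) (x0 := x0) hδ1.le hβ hM hh hd (by linarith)
    (huc.mono (prod_mono st sx))
    (fun t ht x hx => (hus t ⟨hta.trans_lt ht.1, ht.2.trans_lt hT⟩ x (sx (Ioo_subset_Icc_self hx))).mono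
      hδ1.le le_rfl (by
        have := hv0 t (st (Ioc_subset_Icc_self ht)) x (sx (Ioo_subset_Icc_self hx))
        positivity)) hi (fun t ht x hx => hu0 t (st ht) x (sx hx))
  set N2 := c₁ * (M / 2) ^ q with hN2
  have hN2p : 0 < N2 := by positivity
  have sx2 : Icc (x0 - d / 2) (x0 + d / 2) ⊆ Icc (c - L0) (c + L0) :=
    Icc_subset_Icc (by linarith) (by linarith)
  have k2 := growth (f := v) (t0 := t0) (x0 := x0) (d := d / 2) hδ2.le hβ hN2p hh (by positivity) (by
      have : 4 * δ2 * (1 + β * (d / 2)) * h ≤ 4 * δ2 * (1 + β * d) * h := by gcongr; linarith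
      nlinarith)
    (hvc.mono (prod_mono st sx2))
    (fun t ht x hx => (hvs t ⟨hta.trans_lt ht.1, ht.2.trans_lt hT⟩ x (sx2 (Ioo_subset_Icc_self hx))).mono
      hδ2.le le_rfl (by
        have := k1 t (Ioc_subset_Icc_self ht) x (Ioo_subset_Icc_self hx)
        rw [hN2]; gcongr)) (fun t ht x hx => hv0 t (st ht) x (sx2 hx))
  set N3 := c₁ * (N2 * h / 8) ^ p with hN3
  have hN3p : 0 < N3 := by positivity
  have sx3 : Icc (x0 - d / 8) (x0 + d / 8) ⊆ Icc (c - L0) (c + L0) :=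
    Icc_subset_Icc (by linarith) (by linarith)
  have st3 : Icc (t0 + h / 2) (t0 + h / 2 + h / 2) ⊆ Ico ta T :=
    fun t ht => ⟨by linarith [ht.1], by linarith [ht.2]⟩
  have k3 := growth (f := u) (t0 := t0 + h / 2) (h := h / 2) (x0 := x0) (d := d / 8)
    hδ1.le hβ hN3p (by positivity) (by positivity) (by
      have : 4 * δ1 * (1 + β * (d / 8)) * (h / 2) ≤ 4 * δ1 * (1 + β * d) * (h / 2) := by
        gcongr; linarith
      nlinarith)
    (huc.mono (prod_mono st3 sx3))
    (fun t ht x hx => (hus t ⟨by linarith [ht.1], by linarith [ht.2]⟩ x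
      (sx3 (Ioo_subset_Icc_self hx))).mono
      hδ1.le le_rfl (by
        have := k2 t ⟨ht.1.le, by linarith [ht.2]⟩ x ⟨by linarith [hx.1], by linarith [hx.2]⟩
        rw [hN3]; gcongr)) (fun t ht x hx => hu0 t (st3 ht) x (sx3 hx))
    (t0 + h) ⟨by linarith, by linarith⟩ x0 ⟨by linarith, by linarith⟩
  calc N3 * h / 16 = N3 * (h / 2) / 8 := by ring
    _ ≤ _ := k3

lemma alg_id {p q c₁ A X : ℝ} (hp : 1 < p) (hq : 1 < q) (hc₁ : 0 < c₁) (hA : 0 < A) (hX : 0 < X) :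
    c₁ * (c₁ * (X / 2) ^ q * (A * X ^ (-((p * q - 1) / (p + 1)))) / 8) ^ p *
      (A * X ^ (-((p * q - 1) / (p + 1)))) / 16 =
    (c₁ * (c₁ * (1 / 2) ^ q / 8) ^ p / 16) * A ^ (p + 1) * X := by
  set κ := (p * q - 1) / (p + 1) with hκ
  have hκe : κ * (p + 1) = p * q - 1 := by rw [hκ]; field_simp
  have e1 : c₁ * (X / 2) ^ q * (A * X ^ (-κ)) / 8 = (c₁ * (1 / 2) ^ q / 8) * (A * (X ^ (q - κ))) := by
    rw [div_eq_mul_one_div X 2, Real.mul_rpow hX.le (by norm_num), sub_eq_add_neg q κ, Real.rpow_add hX]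
    ring
  rw [e1, Real.mul_rpow (by positivity) (by positivity), Real.mul_rpow (by positivity) (by positivity),
    ← Real.rpow_mul hX.le, Real.rpow_add hA, Real.rpow_one]
  have e2 : X ^ ((q - κ) * p) * X ^ (-κ) = X := by
    rw [← Real.rpow_add hX]
    have : (q - κ) * p + -κ = 1 := by linarith
    rw [this, Real.rpow_one]
  calc _ = (c₁ * (c₁ * (1 / 2) ^ q / 8) ^ p / 16) * (A ^ p * A) * (X ^ ((q - κ) * p) * X ^ (-κ)) := by ring
    _ = _ := by rw [e2]

set_option maxHeartbeats 2000000 in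
lemma typeI {δ1 δ2 β p q c₁ T ta L0 c : ℝ} {u v : ℝ → ℝ → ℝ}
    (hδ1 : 0 < δ1) (hδ2 : 0 < δ2) (hβ : 0 ≤ β) (hp : 1 < p) (hq : 1 < q) (hc₁ : 0 < c₁)
    (hL0 : 0 < L0) (hTa : ta < T)
    (huc : ContinuousOn (Function.uncurry u) (Ico ta T ×ˢ Icc (c - L0) (c + L0)))
    (hvc : ContinuousOn (Function.uncurry v) (Ico ta T ×ˢ Icc (c - L0) (c + L0)))
    (hu0 : ∀ t ∈ Ico ta T, ∀ x ∈ Icc (c - L0) (c + L0), 0 ≤ u t x)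
    (hv0 : ∀ t ∈ Ico ta T, ∀ x ∈ Icc (c - L0) (c + L0), 0 ≤ v t x)
    (hus : ∀ t ∈ Ioo ta T, ∀ x ∈ Icc (c - L0) (c + L0), SupAt δ1 β (c₁ * v t x ^ p) u t x)
    (hvs : ∀ t ∈ Ioo ta T, ∀ x ∈ Icc (c - L0) (c + L0), SupAt δ2 β (c₁ * u t x ^ q) v t x) :
    ∃ C : ℝ, 0 < C ∧ ∀ t0 ∈ Ico ta T, ∀ M : ℝ, (∀ x ∈ Icc (c - L0) (c + L0), M ≤ u t0 x) →
      M ≤ C * (T - t0) ^ (-((p + 1) / (p * q - 1))) := by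
  have hpq : 0 < p * q - 1 := by nlinarith
  set κ := (p * q - 1) / (p + 1) with hκ
  have hκ0 : 0 < κ := by positivity
  have hκi : (p + 1) / (p * q - 1) = κ⁻¹ := by rw [hκ, inv_div]
  rw [hκi]
  set K0 := c₁ * (c₁ * (1 / 2) ^ q / 8) ^ p / 16 with hK0
  have hK0p : 0 < K0 := by positivity
  set A := (2 / K0) ^ (p + 1)⁻¹ with hA
  have hAp : 0 < A := by positivity
  have hAK : K0 * A ^ (p + 1) = 2 := by
    rw [hA, Real.rpow_inv_rpow (by positivity) (by positivity)]; field_simp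
  set Γ := 200 * (δ1 + δ2) * (1 + β * L0) with hΓ
  have hΓp : 0 < Γ := by positivity
  set b := (2:ℝ) ^ (-(κ / 2)) with hb
  have hb0 : 0 < b := by positivity
  have hb1 : b < 1 := Real.rpow_lt_one_of_one_lt_of_neg (by norm_num) (by linarith)
  set a := b ^ 2 with ha
  have ha0 : 0 < a := by positivity
  have ha1 : a < 1 := by rw [ha]; nlinarith
  have ha2 : ∀ k : ℕ, ((2:ℝ) ^ k) ^ (-κ) = a ^ k := by
    intro k
    have : a = 2 ^ (-κ) := by
      rw [ha, hb, ← Real.rpow_natCast, ← Real.rpow_mul (by norm_num)]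
      congr 1; push_cast; ring
    rw [this, ← Real.rpow_natCast, ← Real.rpow_natCast, ← Real.rpow_mul (by norm_num),
      ← Real.rpow_mul (by norm_num), mul_comm]
  set m := min ((1 - a) / A) ((L0 * (1 - b)) ^ 2 / (Γ * A * (T - ta))) with hm
  have hTa' : 0 < T - ta := by linarith
  have h1a : 0 < 1 - a := by linarith
  have h1b : 0 < 1 - b := by linarith
  have hmp : 0 < m := by rw [hm]; positivity
  refine ⟨m ^ (-κ⁻¹), by positivity, fun t0 ht0 M hM => ?_⟩
  by_contra hlt
  push Not at hlt
  have hτ : 0 < T - t0 := by linarith [ht0.2]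
  rw [← Real.mul_rpow hmp.le hτ.le] at hlt
  have hM0 : 0 < M := lt_trans (by positivity) hlt
  have hMk : M ^ (-κ) < m * (T - t0) := by
    have h1 : M ^ (-κ) < ((m * (T - t0)) ^ (-κ⁻¹)) ^ (-κ) :=
      Real.rpow_lt_rpow_of_neg (by positivity) hlt (by linarith)
    rw [← Real.rpow_mul (by positivity), neg_mul_neg, inv_mul_cancel₀ hκ0.ne', Real.rpow_one] at h1
    exact h1
  set H := A * M ^ (-κ) with hH
  have hHp : 0 < H := by positivity
  have hH1 : H / (1 - a) < T - t0 := by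
    rw [div_lt_iff₀ h1a]
    have : m ≤ (1 - a) / A := min_le_left _ _
    calc H < A * (m * (T - t0)) := by rw [hH]; gcongr
      _ ≤ A * ((1 - a) / A * (T - t0)) := by gcongr
      _ = (T - t0) * (1 - a) := by field_simp
  set e := Real.sqrt (Γ * H) with he
  have hep : 0 < e := by rw [he]; positivity
  have he2 : e ^ 2 = Γ * H := Real.sq_sqrt (by positivity)
  have he1 : e / (1 - b) ≤ L0 := by
    rw [div_le_iff₀ h1b]
    apply le_of_sq_le_sq _ (by positivity)
    rw [he2]
    have h2 : m ≤ (L0 * (1 - b)) ^ 2 / (Γ * A * (T - ta)) := min_le_right _ _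
    calc Γ * H ≤ Γ * (A * (m * (T - t0))) := by rw [hH]; gcongr
      _ ≤ Γ * (A * ((L0 * (1 - b)) ^ 2 / (Γ * A * (T - ta)) * (T - ta))) := by
        gcongr; exact ht0.1
      _ = (L0 * (1 - b)) ^ 2 := by field_simp
  set S : ℕ → ℝ := fun k => H / (1 - a) * (1 - a ^ k) with hS
  set D : ℕ → ℝ := fun k => e / (1 - b) * (1 - b ^ k) with hD
  have hSs : ∀ k, S (k + 1) = S k + H * a ^ k := by
    intro k; simp only [hS]; field_simp; ring
  have hDs : ∀ k, D (k + 1) = D k + e * b ^ k := by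
    intro k; simp only [hD]; field_simp; ring
  have hS0 : ∀ k, 0 ≤ S k := fun k => by
    have : a ^ k ≤ 1 := pow_le_one₀ ha0.le ha1.le
    exact mul_nonneg (by positivity) (by linarith)
  have hS1 : ∀ k, S k ≤ H / (1 - a) := fun k => by
    have h1 : 0 < a ^ k := by positivity
    have h2 : 0 < H / (1 - a) := by positivity
    simp only [hS]; nlinarith
  have hD0 : ∀ k, 0 ≤ D k := fun k => by
    have : b ^ k ≤ 1 := pow_le_one₀ hb0.le hb1.le
    exact mul_nonneg (by positivity) (by linarith)
  have hD1 : ∀ k, D k ≤ L0 := fun k => by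
    have h1 : 0 < b ^ k := by positivity
    have h2 : 0 < e / (1 - b) := by positivity
    simp only [hD]; nlinarith
  have claim : ∀ k : ℕ, ∀ x ∈ Icc (c - (L0 - D k)) (c + (L0 - D k)), 2 ^ k * M ≤ u (t0 + S k) x := by
    intro k
    induction k with
    | zero =>
      intro x hx
      simp [hS, hD] at hx ⊢
      exact hM x ⟨by linarith [hx.1], by linarith [hx.2]⟩
    | succ k ih =>
      intro x hx
      rw [hDs] at hx
      rw [hSs, ← add_assoc]
      have hX : 0 < 2 ^ k * M := by positivity
      have hh : H * a ^ k = A * (2 ^ k * M) ^ (-κ) := by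
        rw [Real.mul_rpow (by positivity) hM0.le, ha2, hH]; ring
      have hbk : 0 < e * b ^ k := by positivity
      have := doubling (t0 := t0 + S k) (h := H * a ^ k) (d := e * b ^ k) (x0 := x) (M := 2 ^ k * M)
        hδ1 hδ2 hβ hp hq hc₁ huc hvc hu0 hv0 hus hvs (by linarith [ht0.1, hS0 k]) hX (by positivity)
        hbk (by have := hSs k; linarith [hS1 (k + 1)]) (by linarith [hx.1, hD0 k])
        (by linarith [hx.2, hD0 k])
        (by
          have : (e * b ^ k) ^ 2 = Γ * (H * a ^ k) := by
            rw [mul_pow, he2, ha]; ring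
          rw [this])
        (fun y hy => ih y ⟨by linarith [hy.1, hx.1], by linarith [hy.2, hx.2]⟩)
      rw [hh, alg_id hp hq hc₁ hAp hX, ← hK0, hAK] at this
      rw [hh]
      calc (2:ℝ) ^ (k + 1) * M = 2 * (2 ^ k * M) := by ring
        _ ≤ _ := this
  have hcomp : ContinuousOn (fun t => u t c) (Icc t0 (t0 + H / (1 - a))) := by
    have : ContinuousOn (fun t : ℝ => ((t, c) : ℝ × ℝ)) (Icc t0 (t0 + H / (1 - a))) := by fun_prop
    refine huc.comp this ?_
    intro t ht
    exact ⟨⟨ht0.1.trans ht.1, by linarith [ht.2]⟩, ⟨by linarith, by linarith⟩⟩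
  obtain ⟨Bd, hBd⟩ := (isCompact_Icc.image_of_continuousOn hcomp).bddAbove
  obtain ⟨k, hk⟩ := pow_unbounded_of_one_lt (Bd / M) (one_lt_two : (1:ℝ) < 2)
  rw [div_lt_iff₀ hM0] at hk
  have h1 := claim k c ⟨by linarith [hD1 k], by linarith [hD1 k]⟩
  have h2 := hBd (mem_image_of_mem (fun t => u t c)
    (show t0 + S k ∈ Icc t0 (t0 + H / (1 - a)) from ⟨by linarith [hS0 k], by linarith [hS1 k]⟩))
  linarith


lemma SupAt.scale {δ β N a κ T ρ s y : ℝ} {f : ℝ → ℝ → ℝ} (ha : 0 < a) (hκ : 0 < κ)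
    (h : SupAt δ β N f (T + a ^ 2 * s) (ρ + a * y)) :
    SupAt δ (a * β) (κ * a ^ 2 * N) (fun s y => κ * f (T + a ^ 2 * s) (ρ + a * y)) s y := by
  obtain ⟨ft, h1, h2⟩ := h
  refine ⟨κ * (ft * (a ^ 2 * 1)), ?_, fun c1 c2 hc => ?_⟩
  · have h3 : HasDerivAt (fun s : ℝ => T + a ^ 2 * s) (a ^ 2 * 1) s :=
      ((hasDerivAt_id s).const_mul _).const_add T
    have := (HasDerivAt.comp s h1 h3).const_mul κ
    exact this
  · have h4 := h2 (c1 / (κ * a)) (c2 / (κ * a ^ 2)) (by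
      have hm : Tendsto (fun x' : ℝ => (x' - ρ) / a) (nhds (ρ + a * y)) (nhds y) := by
        have : ContinuousAt (fun x' : ℝ => (x' - ρ) / a) (ρ + a * y) := by fun_prop
        have e : (ρ + a * y - ρ) / a = y := by field_simp; ring
        rw [ContinuousAt, e] at this; exact this
      filter_upwards [hm.eventually hc] with x' hx'
      have e1 : ρ + a * ((x' - ρ) / a) = x' := by field_simp; ring
      rw [e1] at hx'
      have e2 : (x' - ρ) / a - y = (x' - (ρ + a * y)) / a := by field_simp; ring
      rw [e2] at hx'
      have e3 : κ * (f (T + a ^ 2 * s) (ρ + a * y) + c1 / (κ * a) * (x' - (ρ + a * y)) +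
          c2 / (κ * a ^ 2) * (x' - (ρ + a * y)) ^ 2) = κ * f (T + a ^ 2 * s) (ρ + a * y) +
          c1 * ((x' - (ρ + a * y)) / a) + c2 * ((x' - (ρ + a * y)) / a) ^ 2 := by
        field_simp
      rw [← e3] at hx'
      exact le_of_mul_le_mul_left hx' hκ)
    have h5 : κ * a ^ 2 * N ≤ κ * a ^ 2 * (ft - 2 * δ * (c2 / (κ * a ^ 2)) + δ * β * |c1 / (κ * a)|) := by
      gcongr
    rw [abs_div, abs_of_pos (by positivity : 0 < κ * a)] at h5
    have e : κ * a ^ 2 * (ft - 2 * δ * (c2 / (κ * a ^ 2)) + δ * β * (|c1| / (κ * a))) =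
      κ * (ft * (a ^ 2 * 1)) - 2 * δ * c2 + δ * (a * β) * |c1| := by field_simp
    linarith

lemma AA {Ω : Set (ℝ × ℝ)} (hΩ : IsOpen Ω) (f : ℕ → ℝ × ℝ → ℝ)
    (hb : ∀ x ∈ Ω, ∃ B : ℝ, ∀ᶠ j in atTop, |f j x| ≤ B)
    (he : ∀ x ∈ Ω, ∀ η > 0, ∃ U ∈ nhds x, ∀ᶠ j in atTop, ∀ y ∈ U, |f j y - f j x| ≤ η) :
    ∃ k : ℕ → ℕ, StrictMono k ∧ ∃ g : ℝ × ℝ → ℝ, ∀ K ⊆ Ω, IsCompact K → ∀ ε > 0,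
      ∀ᶠ j in atTop, ∀ x ∈ K, |f (k j) x - g x| ≤ ε := by
  set d : ℕ → ℝ × ℝ := TopologicalSpace.denseSeq (ℝ × ℝ) with hd
  have hdense : DenseRange d := TopologicalSpace.denseRange_denseSeq _
  have hB : ∀ i, ∃ B : ℝ, d i ∈ Ω → ∀ᶠ j in atTop, |f j (d i)| ≤ B := by
    intro i
    by_cases h : d i ∈ Ω
    · obtain ⟨B, h1⟩ := hb _ h; exact ⟨B, fun _ => h1⟩
    · exact ⟨0, fun h' => absurd h' h⟩
  choose B hB using hB
  set a : ℕ → ℕ → ℝ := fun j i => max (-|B i|) (min |B i| (f j (d i))) with ha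
  have hcomp : IsCompact (Set.pi univ (fun i => Icc (-|B i|) |B i|)) :=
    isCompact_univ_pi fun i => isCompact_Icc
  obtain ⟨l, -, k, hk, hl⟩ := hcomp.tendsto_subseq (x := a) (fun j i _ =>
    ⟨le_max_left _ _, max_le (by linarith [abs_nonneg (B i)]) (min_le_left _ _)⟩)
  rw [tendsto_pi_nhds] at hl
  have hl' : ∀ i, d i ∈ Ω → Tendsto (fun j => f (k j) (d i)) atTop (nhds (l i)) := by
    intro i hi
    refine (hl i).congr' ?_
    filter_upwards [hk.tendsto_atTop.eventually (hB i hi)] with j hj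
    have h1 := abs_le.1 (hj.trans (le_abs_self (B i)))
    simp only [ha, Function.comp]
    rw [min_eq_right h1.2, max_eq_right h1.1]
  have hlim : ∀ x, ∃ y : ℝ, x ∈ Ω → Tendsto (fun j => f (k j) x) atTop (nhds y) := by
    intro x
    by_cases hx : x ∈ Ω
    · suffices h : CauchySeq (fun j => f (k j) x) by
        obtain ⟨y, hy⟩ := cauchySeq_tendsto_of_complete h
        exact ⟨y, fun _ => hy⟩
      rw [Metric.cauchySeq_iff]
      intro ε hε
      obtain ⟨U, hU, hUj⟩ := he x hx (ε / 4) (by positivity)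
      obtain ⟨z, hz, i, rfl⟩ := hdense.exists_mem_open (isOpen_interior)
        ⟨x, mem_interior_iff_mem_nhds.2 (inter_mem hU (hΩ.mem_nhds hx))⟩ |>.imp
          (fun i hi => (⟨hi, i, rfl⟩ : d i ∈ interior (U ∩ Ω) ∧ ∃ i', d i' = d i)) |> fun ⟨i, h⟩ =>
            (⟨d i, h⟩ : ∃ z, z ∈ interior (U ∩ Ω) ∧ ∃ i', d i' = z)
      have hz' := interior_subset hz
      have hc := Metric.cauchySeq_iff.1 (hl' i hz'.2).cauchySeq (ε / 4) (by positivity)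
      obtain ⟨n1, hn1⟩ := hc
      obtain ⟨n2, hn2⟩ := eventually_atTop.1 (hk.tendsto_atTop.eventually hUj)
      refine ⟨max n1 n2, fun m hm n hn => ?_⟩
      have h1 := hn1 m (le_trans (le_max_left _ _) hm) n (le_trans (le_max_left _ _) hn)
      have h2 := abs_le.1 (hn2 m (le_trans (le_max_right _ _) hm) _ hz'.1)
      have h3 := abs_le.1 (hn2 n (le_trans (le_max_right _ _) hn) _ hz'.1)
      rw [Real.dist_eq, abs_lt] at h1
      rw [Real.dist_eq, abs_lt]
      constructor <;> linarith
    · exact ⟨0, fun h' => absurd h' hx⟩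
  choose g hg using hlim
  refine ⟨k, hk, g, fun K hK hKc ε hε => ?_⟩
  refine hKc.induction_on (p := fun S => ∀ᶠ j in atTop, ∀ x ∈ S, |f (k j) x - g x| ≤ ε) ?_ ?_ ?_ ?_
  · simp
  · intro s t hst ht
    filter_upwards [ht] with j hj x hx using hj x (hst hx)
  · intro s t hs ht
    filter_upwards [hs, ht] with j h1 h2 x hx
    exact hx.elim (h1 x) (h2 x)
  · intro x hx
    obtain ⟨U, hU, hUj⟩ := he x (hK hx) (ε / 3) (by positivity)
    refine ⟨U ∩ Ω, mem_nhdsWithin_of_mem_nhds (inter_mem hU (hΩ.mem_nhds (hK hx))), ?_⟩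
    have hev := hk.tendsto_atTop.eventually hUj
    have hg1 : ∀ y ∈ U ∩ Ω, |g y - g x| ≤ ε / 3 := by
      intro y hy
      refine le_of_tendsto ((hg y hy.2).sub (hg x (hK hx))).abs ?_
      filter_upwards [hev] with j hj using hj y hy.1
    filter_upwards [hev, (Metric.tendsto_nhds.1 (hg x (hK hx))) (ε / 3) (by positivity)] with j h1 h2 y hy
    have e1 := abs_le.1 (h1 y hy.1)
    rw [Real.dist_eq, abs_lt] at h2
    have e3 := abs_le.1 (hg1 y hy)
    rw [abs_le]; constructor <;> linarith [h2.1, h2.2]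

lemma dist_ineq {α c₁ : ℝ} {φ Q ξ : ℝ → ℝ} (hφ : Continuous φ) (hQ : Continuous Q)
    (hineq : ∀ σ : ℝ, ∀ h ≥ 0, c₁ * Q σ * (1 - Real.exp (-h)) ≤ φ (σ + h) * Real.exp (α * h) - φ σ)
    (hξ : ContDiff ℝ (⊤ : ℕ∞) ξ) (hs : HasCompactSupport ξ) (hξ0 : ∀ x, 0 ≤ ξ x) :
    c₁ * ∫ σ : ℝ, Q σ * ξ σ ≤ ∫ σ : ℝ, (-(φ σ) * deriv ξ σ + α * φ σ * ξ σ) := by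
  have hξc : Continuous ξ := hξ.continuous
  set ζ : ℝ → ℝ := fun x => ξ (-x) with hζ
  have hζs : HasCompactSupport ζ := hs.comp_homeomorph (Homeomorph.neg ℝ)
  have hζ1 : ContDiff ℝ 1 ζ := (hξ.comp contDiff_neg).of_le (by exact_mod_cast le_top)
  have hder := HasCompactSupport.hasDerivAt_convolution_right (ContinuousLinearMap.mul ℝ ℝ)
    (μ := volume) (f₀ := φ) (hf := hφ.locallyIntegrable) (hcg := hζs) (hg := hζ1) (x₀ := 0)
  set J : ℝ → ℝ := fun h => ∫ σ, φ σ * ξ (σ - h) with hJ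
  have hJeq : (MeasureTheory.convolution φ ζ (ContinuousLinearMap.mul ℝ ℝ) volume) = J := by
    funext h
    simp only [MeasureTheory.convolution, hJ, hζ, ContinuousLinearMap.mul_apply', neg_sub]
  have hdζ : ∀ x, deriv ζ x = - deriv ξ (-x) := fun x => by
    simp only [hζ]; rw [deriv_comp_neg]
  have hJ' : HasDerivAt J (∫ σ, -(φ σ * deriv ξ σ)) 0 := by
    rw [hJeq] at hder
    refine hder.congr_deriv ?_
    simp only [MeasureTheory.convolution, ContinuousLinearMap.mul_apply', hdζ]
    congr 1; funext σ; simp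
  have hJ0 : J 0 = ∫ σ, φ σ * ξ σ := by simp [hJ]
  set I := ∫ σ, Q σ * ξ σ with hI
  have hint : ∀ (a b : ℝ → ℝ), Continuous a → Continuous b → HasCompactSupport b →
      Integrable (fun x => a x * b x) := fun a b ha hb hbs =>
    (ha.mul hb).integrable_of_hasCompactSupport hbs.mul_left
  have hsh : ∀ h, HasCompactSupport (fun x => ξ (x - h)) := fun h => by
    have := hs.comp_homeomorph (Homeomorph.subRight h); exact this
  have key : ∀ h ≥ 0, c₁ * I * (1 - Real.exp (-h)) ≤ J h * Real.exp (α * h) - J 0 := by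
    intro h hh
    have e1 : J h = ∫ σ, φ (σ + h) * ξ σ := by
      simp only [hJ]
      rw [← integral_add_right_eq_self (fun σ => φ σ * ξ (σ - h)) h]
      simp
    have i1 : Integrable (fun σ => φ (σ + h) * ξ σ) := hint _ _ (by fun_prop) hξc hs
    have i2 : Integrable (fun σ => φ σ * ξ σ) := hint _ _ hφ hξc hs
    have i3 : Integrable (fun σ => Q σ * ξ σ) := hint _ _ hQ hξc hs
    have : ∫ σ, c₁ * (1 - Real.exp (-h)) * (Q σ * ξ σ) ≤
        ∫ σ, (Real.exp (α * h) * (φ (σ + h) * ξ σ) - φ σ * ξ σ) := by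
      apply integral_mono (i3.const_mul _) ((i1.const_mul _).sub i2)
      intro σ
      have := mul_le_mul_of_nonneg_right (hineq σ h hh) (hξ0 σ)
      simp only [Pi.sub_apply]
      linarith
    rw [integral_const_mul, integral_sub (i1.const_mul _) i2, integral_const_mul, ← e1, ← hJ0] at this
    linarith
  set k : ℝ → ℝ := fun h => J h * Real.exp (α * h) - J 0 - c₁ * I * (1 - Real.exp (-h)) with hk
  have hexp1 : HasDerivAt (fun h : ℝ => Real.exp (α * h)) (Real.exp (α * 0) * (α * 1)) 0 :=
    ((hasDerivAt_id (0:ℝ)).const_mul α).exp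
  have hexp2 : HasDerivAt (fun h : ℝ => Real.exp (-h)) (Real.exp (-0) * (-1)) 0 :=
    ((hasDerivAt_id (0:ℝ)).neg).exp
  have hk' : HasDerivAt k (((∫ σ, -(φ σ * deriv ξ σ)) * Real.exp (α * 0) +
      J 0 * (Real.exp (α * 0) * (α * 1))) - c₁ * I * (-(Real.exp (-0) * (-1)))) 0 :=
    ((hJ'.mul hexp1).sub_const (J 0)).sub ((hexp2.const_sub 1).const_mul (c₁ * I))
  have hk0 : k 0 = 0 := by simp [hk]
  have hnn : 0 ≤ ((∫ σ, -(φ σ * deriv ξ σ)) * Real.exp (α * 0) +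
      J 0 * (Real.exp (α * 0) * (α * 1))) - c₁ * I * (-(Real.exp (-0) * (-1))) := by
    have h1 := (hasDerivWithinAt_iff_tendsto_slope' (s := Ioi (0:ℝ)) (x := 0) (by simp)).1
      (hk'.hasDerivWithinAt (s := Ioi 0))
    refine ge_of_tendsto h1 ?_
    filter_upwards [self_mem_nhdsWithin] with h hh
    rw [slope_def_field, hk0]
    have : 0 ≤ k h := by have := key h (le_of_lt hh); simp only [hk]; linarith
    have hh' : (0:ℝ) < h := hh
    exact div_nonneg (by linarith) (by linarith)
  have hdc : Continuous (deriv ξ) := hξ.continuous_deriv (by exact_mod_cast le_top)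
  have i4 : Integrable (fun σ => φ σ * deriv ξ σ) := hint _ _ hφ hdc hs.deriv
  have i5 : Integrable (fun σ => φ σ * ξ σ) := hint _ _ hφ hξc hs
  have efin : ∫ σ : ℝ, (-(φ σ) * deriv ξ σ + α * φ σ * ξ σ) =
      (∫ σ, -(φ σ * deriv ξ σ)) + α * J 0 := by
    have i4' : Integrable (fun σ => -(φ σ * deriv ξ σ)) := i4.neg
    rw [hJ0, ← integral_const_mul, ← integral_add i4' (i5.const_mul α)]
    congr 1; funext σ; ring
  rw [efin]
  simp at hnn
  linarith


def Good (δ c₁ p α C : ℝ) (U V : ℕ → ℝ → ℝ → ℝ) : Prop :=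
  ∀ sa sb : ℝ, sb < 0 → ∃ N : ℝ, 0 ≤ N ∧ ∀ L : ℝ, ∀ ε > 0, ∀ᶠ j in atTop,
    ContinuousOn (Function.uncurry (U j)) (Icc sa sb ×ˢ Icc (-L) L) ∧
    (∀ s ∈ Icc sa sb, AntitoneOn (U j s) (Icc (-L) L)) ∧
    ∀ s ∈ Icc sa sb, ∀ y ∈ Icc (-L) L, 0 ≤ U j s y ∧ U j s y ≤ C * (-s) ^ (-α) ∧ 0 ≤ V j s y ∧
      SupAt δ ε (c₁ * V j s y ^ p) (U j) s y ∧ SupAt δ ε (-N) (fun t x => - U j t x) s y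

def Lim (U : ℕ → ℝ → ℝ → ℝ) (g : ℝ × ℝ → ℝ) : Prop :=
  ∀ K ⊆ Iio (0:ℝ) ×ˢ (univ : Set ℝ), IsCompact K → ∀ ε > 0,
      ∀ᶠ j in atTop, ∀ x ∈ K, |U j x.1 x.2 - g x| ≤ ε

lemma Good.sub {δ c₁ p α C : ℝ} {U V : ℕ → ℝ → ℝ → ℝ} (h : Good δ c₁ p α C U V) {k : ℕ → ℕ}
    (hk : StrictMono k) : Good δ c₁ p α C (fun j => U (k j)) (fun j => V (k j)) := by
  intro sa sb hsb
  obtain ⟨N, hN, h1⟩ := h sa sb hsb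
  exact ⟨N, hN, fun L ε hε => hk.tendsto_atTop.eventually (h1 L ε hε)⟩

lemma Lim.sub {U : ℕ → ℝ → ℝ → ℝ} {g : ℝ × ℝ → ℝ} (h : Lim U g) {k : ℕ → ℕ}
    (hk : StrictMono k) : Lim (fun j => U (k j)) g :=
  fun K hK hKc ε hε => hk.tendsto_atTop.eventually (h K hK hKc ε hε)

lemma Good.lim {δ c₁ p α C : ℝ} {U V : ℕ → ℝ → ℝ → ℝ} (h : Good δ c₁ p α C U V)
    (hδ : 0 < δ) (hc₁ : 0 ≤ c₁) (hα : 0 < α) (hC : 0 ≤ C) :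
    ∃ k : ℕ → ℕ, StrictMono k ∧ ∃ g, Lim (fun j => U (k j)) g := by
  refine AA (Ω := Iio (0:ℝ) ×ˢ (univ : Set ℝ)) (isOpen_Iio.prod isOpen_univ)
    (fun j x => U j x.1 x.2) ?_ ?_
  · rintro ⟨s, y⟩ ⟨hs, -⟩
    simp only [mem_Iio] at hs
    obtain ⟨N, hN, h1⟩ := h s s hs
    refine ⟨C * (-s) ^ (-α), ?_⟩
    filter_upwards [h1 |y| 1 one_pos] with j hj
    have := hj.2.2 s ⟨le_rfl, le_rfl⟩ y ⟨neg_abs_le y, le_abs_self y⟩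
    rw [abs_of_nonneg this.1]
    exact this.2.1
  · rintro ⟨s, y⟩ ⟨hs, -⟩ η hη
    simp only [mem_Iio] at hs
    set τ := -s / 4 with hτ
    have hτ0 : 0 < τ := by rw [hτ]; linarith
    have hsb : s + τ < 0 := by rw [hτ]; linarith
    obtain ⟨N, hN, h1⟩ := h (s - 2 * τ) (s + τ) hsb
    have hM : 0 ≤ C * (-(s + τ)) ^ (-α) := mul_nonneg hC (Real.rpow_nonneg (by linarith) _)
    obtain ⟨r, hr, h2⟩ := equi_est δ _ N τ η hδ hM hN hτ0 hη
    refine ⟨Metric.closedBall (s, y) r, Metric.closedBall_mem_nhds _ hr, ?_⟩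
    filter_upwards [h1 (|y| + 4) (1 / 4) (by norm_num)] with j ⟨j1, j2, j3⟩
    rintro ⟨s', y'⟩ hx
    simp only [Metric.mem_closedBall, Prod.dist_eq, Real.dist_eq] at hx
    have hsub : Icc (y - 4) (y + 4) ⊆ Icc (-(|y| + 4)) (|y| + 4) :=
      Icc_subset_Icc (by linarith [neg_abs_le y]) (by linarith [le_abs_self y])
    refine h2 (1 / 4) s y (U j) (by norm_num) le_rfl (j1.mono (prod_mono le_rfl hsub)) ?_
      (fun t ht => (j2 t ht).mono hsub) ?_ s' y' ((le_max_left _ _).trans hx)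
      ((le_max_right _ _).trans hx)
    · intro t ht x hx
      obtain ⟨a1, a2, -⟩ := j3 t ht x (hsub hx)
      refine ⟨a1, a2.trans ?_⟩
      apply mul_le_mul_of_nonneg_left _ hC
      exact Real.rpow_le_rpow_of_nonpos (by linarith) (by linarith [ht.2]) (by linarith)
    · intro t ht x hx
      obtain ⟨-, -, a3, a4, a5⟩ := j3 t ht x (hsub hx)
      refine ⟨a4.mono hδ.le le_rfl ?_, a5⟩
      have : 0 ≤ c₁ * V j t x ^ p := mul_nonneg hc₁ (Real.rpow_nonneg a3 _)
      linarith

lemma Lim.pt {U : ℕ → ℝ → ℝ → ℝ} {g : ℝ × ℝ → ℝ} (h : Lim U g) {s y : ℝ} (hs : s < 0) :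
    Tendsto (fun j => U j s y) atTop (nhds (g (s, y))) := by
  rw [Metric.tendsto_nhds]
  intro ε hε
  filter_upwards [h {(s, y)} (by rintro _ rfl; exact ⟨hs, mem_univ _⟩) isCompact_singleton (ε / 2)
    (by positivity)] with j hj
  have := hj (s, y) rfl
  rw [Real.dist_eq]; simp only [] at this; linarith

lemma Good.bounds {δ c₁ p α C : ℝ} {U V : ℕ → ℝ → ℝ → ℝ} (h : Good δ c₁ p α C U V)
    {g : ℝ × ℝ → ℝ} (hl : Lim U g) {s : ℝ} (hs : s < 0) (y : ℝ) :
    0 ≤ g (s, y) ∧ g (s, y) ≤ C * (-s) ^ (-α) := by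
  obtain ⟨N, hN, h1⟩ := h s s hs
  have hev := h1 |y| 1 one_pos
  have ht := hl.pt (y := y) hs
  constructor
  · refine ge_of_tendsto ht ?_
    filter_upwards [hev] with j hj
    exact (hj.2.2 s ⟨le_rfl, le_rfl⟩ y ⟨neg_abs_le y, le_abs_self y⟩).1
  · refine le_of_tendsto ht ?_
    filter_upwards [hev] with j hj
    exact (hj.2.2 s ⟨le_rfl, le_rfl⟩ y ⟨neg_abs_le y, le_abs_self y⟩).2.1

lemma Good.anti {δ c₁ p α C : ℝ} {U V : ℕ → ℝ → ℝ → ℝ} (h : Good δ c₁ p α C U V)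
    {g : ℝ × ℝ → ℝ} (hl : Lim U g) {s : ℝ} (hs : s < 0) : Antitone (fun y => g (s, y)) := by
  intro y y' hy
  obtain ⟨N, hN, h1⟩ := h s s hs
  have hev := h1 (max |y| |y'|) 1 one_pos
  refine le_of_tendsto_of_tendsto (hl.pt hs) (hl.pt hs) ?_
  filter_upwards [hev] with j hj
  refine hj.2.1 s ⟨le_rfl, le_rfl⟩ ⟨?_, ?_⟩ ⟨?_, ?_⟩ hy
  · linarith [neg_abs_le y, le_max_left |y| |y'|]
  · linarith [le_abs_self y, le_max_left |y| |y'|]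
  · linarith [neg_abs_le y', le_max_right |y| |y'|]
  · linarith [le_abs_self y', le_max_right |y| |y'|]

lemma Good.grow {δ c₁ p α C : ℝ} {U V : ℕ → ℝ → ℝ → ℝ} (h : Good δ c₁ p α C U V)
    (hδ : 0 < δ) (hc₁ : 0 ≤ c₁) (hp : 0 < p)
    {g g' : ℝ × ℝ → ℝ} (hl : Lim U g) (hl' : Lim V g') {s1 s2 a m : ℝ} (h12 : s1 ≤ s2) (hs2 : s2 < 0)
    (hm : 0 ≤ m) (ha : ∀ y, a ≤ g (s1, y)) (hgm : ∀ s ∈ Icc s1 s2, ∀ y, m ≤ g' (s, y)) (y0 : ℝ) :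
    a + c₁ * m ^ p * (s2 - s1) ≤ g (s2, y0) := by
  obtain ⟨N, hN, h1⟩ := h s1 s2 hs2
  have key : ∀ ε > 0, a - ε + (c₁ * (max (m - ε) 0) ^ p -
      4 * δ * ((|a| + c₁ * m ^ p * (s2 - s1)) * ε ^ 2)) * (s2 - s1) - ε ≤ g (s2, y0) := by
    intro ε hε
    set L := |y0| + 1 / ε with hL
    have hKc : IsCompact (Icc s1 s2 ×ˢ Icc (-L) L) := isCompact_Icc.prod isCompact_Icc
    have hKs : Icc s1 s2 ×ˢ Icc (-L) L ⊆ Iio (0:ℝ) ×ˢ (univ : Set ℝ) :=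
      prod_mono (fun s hs => lt_of_le_of_lt hs.2 hs2) (subset_univ _)
    obtain ⟨j, ⟨j1, j2, j3⟩, j4, j5⟩ := ((h1 L ε hε).and ((hl _ hKs hKc ε hε).and
      (hl' _ hKs hKc ε hε))).exists
    have hε' : 0 < 1 / ε := by positivity
    have hsub : Icc (y0 - 1 / ε) (y0 + 1 / ε) ⊆ Icc (-L) L :=
      Icc_subset_Icc (by rw [hL]; linarith [neg_abs_le y0]) (by rw [hL]; linarith [le_abs_self y0])
    have hmp : 0 ≤ c₁ * m ^ p := mul_nonneg hc₁ (Real.rpow_nonneg hm _)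
    have hNn : 0 ≤ c₁ * (max (m - ε) 0) ^ p := mul_nonneg hc₁ (Real.rpow_nonneg (le_max_right _ _) _)
    have hNm : c₁ * (max (m - ε) 0) ^ p ≤ c₁ * m ^ p := by
      gcongr
      exact max_le (by linarith) hm
    have h12' : 0 ≤ s2 - s1 := by linarith
    have hmem : ∀ t ∈ Icc s1 s2, ∀ x ∈ Icc (y0 - 1 / ε) (y0 + 1 / ε),
      ((t, x) : ℝ × ℝ) ∈ Icc s1 s2 ×ˢ Icc (-L) L := fun t ht x hx => ⟨ht, hsub hx⟩
    have := wide_barrier (f := U j) (x0 := y0) (L := 1 / ε) (M := 0) (a := a - ε) (β := ε)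
      (N := c₁ * (max (m - ε) 0) ^ p)
      (D := (|a| + c₁ * m ^ p * (s2 - s1)) * ε ^ 2) hδ.le hε.le hε'.le (by positivity)
      (by rw [mul_one_div_cancel hε.ne']) h12
      (by
        rw [abs_of_nonneg hNn]
        have e : (|a| + c₁ * m ^ p * (s2 - s1)) * ε ^ 2 * (1 / ε) ^ 2 =
          |a| + c₁ * m ^ p * (s2 - s1) := by field_simp
        rw [e]
        have : c₁ * (max (m - ε) 0) ^ p * (s2 - s1) ≤ c₁ * m ^ p * (s2 - s1) := by gcongr
        linarith [le_abs_self a])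
      (j1.mono (prod_mono le_rfl hsub))
      (fun t ht x hx => by
        have ht' := Ioc_subset_Icc_self ht
        have hx' := Ioo_subset_Icc_self hx
        obtain ⟨-, -, a3, a4, -⟩ := j3 t ht' x (hsub hx')
        refine a4.mono hδ.le le_rfl ?_
        gcongr
        refine max_le ?_ a3
        have b1 := abs_le.1 (j5 (t, x) (hmem t ht' x hx'))
        have b2 := hgm t ht' x
        simp only [] at b1
        linarith)
      (fun x hx => by
        have b1 := abs_le.1 (j4 (s1, x) (hmem s1 ⟨le_rfl, h12⟩ x hx))
        have b2 := ha x
        simp only [] at b1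
        linarith)
      (fun t ht x hx => by
        have := (j3 t ht x (hsub hx)).1
        linarith)
    have b1 := abs_le.1 (j4 (s2, y0) (hmem s2 ⟨h12, le_rfl⟩ y0 ⟨by linarith, by linarith⟩))
    simp only [] at b1
    linarith
  have hcont : Continuous (fun ε : ℝ => a - ε + (c₁ * (max (m - ε) 0) ^ p -
      4 * δ * ((|a| + c₁ * m ^ p * (s2 - s1)) * ε ^ 2)) * (s2 - s1) - ε) := by
    have : Continuous (fun ε : ℝ => (max (m - ε) 0) ^ p) :=
      Continuous.rpow_const (by fun_prop) (fun _ => Or.inr hp.le)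
    fun_prop
  have hlim := (hcont.tendsto 0).mono_left (nhdsWithin_le_nhds (s := Ioi 0))
  have := le_of_tendsto hlim (by filter_upwards [self_mem_nhdsWithin] with ε hε using key ε hε)
  simpa [max_eq_left hm] using this

lemma Good.upper {δ c₁ p α C : ℝ} {U V : ℕ → ℝ → ℝ → ℝ} (h : Good δ c₁ p α C U V)
    (hδ : 0 < δ) (hα : 0 < α) (hC : 0 ≤ C)
    {g : ℝ × ℝ → ℝ} (hl : Lim U g) (sa sb : ℝ) (hsb : sb < 0) :
    ∃ N : ℝ, 0 ≤ N ∧ ∀ s1 ∈ Icc sa sb, ∀ s2 ∈ Icc sa sb, s1 ≤ s2 →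
      (⨅ y, g (s2, y)) ≤ (⨅ y, g (s1, y)) + N * (s2 - s1) := by
  obtain ⟨N, hN, h1⟩ := h sa sb hsb
  refine ⟨N, hN, fun s1 hs1 s2 hs2 h12 => ?_⟩
  have hs10 : s1 < 0 := lt_of_le_of_lt hs1.2 hsb
  have hs20 : s2 < 0 := lt_of_le_of_lt hs2.2 hsb
  set M := C * (-sb) ^ (-α) with hM
  have hM0 : 0 ≤ M := mul_nonneg hC (Real.rpow_nonneg (by linarith) _)
  have h12' : 0 ≤ s2 - s1 := by linarith
  have hbdd : BddBelow (range fun y => g (s2, y)) :=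
    ⟨0, by rintro _ ⟨y, rfl⟩; exact (h.bounds hl hs20 y).1⟩
  suffices hs : ∀ y1, (⨅ y, g (s2, y)) - N * (s2 - s1) ≤ g (s1, y1) by
    have := le_ciInf hs
    linarith
  intro y1
  have key : ∀ ε > 0, (⨅ y, g (s2, y)) ≤
      g (s1, y1) + ε + (N + 4 * δ * ((M + N * (s2 - s1)) * ε ^ 2)) * (s2 - s1) + ε := by
    intro ε hε
    have hε' : 0 < 1 / ε := by positivity
    set y0 := y1 + 1 / ε with hy0
    set L := |y0| + 1 / ε with hL
    have hKc : IsCompact (Icc s1 s2 ×ˢ Icc (-L) L) := isCompact_Icc.prod isCompact_Icc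
    have hKs : Icc s1 s2 ×ˢ Icc (-L) L ⊆ Iio (0:ℝ) ×ˢ (univ : Set ℝ) :=
      prod_mono (fun s hs => lt_of_le_of_lt hs.2 hs20) (subset_univ _)
    obtain ⟨j, ⟨j1, j2, j3⟩, j4⟩ := ((h1 L ε hε).and (hl _ hKs hKc ε hε)).exists
    have hsub : Icc (y0 - 1 / ε) (y0 + 1 / ε) ⊆ Icc (-L) L :=
      Icc_subset_Icc (by rw [hL]; linarith [neg_abs_le y0]) (by rw [hL]; linarith [le_abs_self y0])
    have hst : Icc s1 s2 ⊆ Icc sa sb := Icc_subset_Icc hs1.1 hs2.2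
    have hy1m : y1 ∈ Icc (y0 - 1 / ε) (y0 + 1 / ε) := ⟨by rw [hy0]; linarith, by rw [hy0]; linarith⟩
    have hg0 := (h.bounds hl hs10 y1).1
    have := wide_barrier (f := fun t x => - U j t x) (x0 := y0) (L := 1 / ε) (M := M)
      (a := -(g (s1, y1) + ε)) (β := ε) (N := -N)
      (D := (M + N * (s2 - s1)) * ε ^ 2) hδ.le hε.le hε'.le (by positivity)
      (by rw [mul_one_div_cancel hε.ne']) h12
      (by
        rw [abs_neg, abs_of_nonneg hN]
        have e : (M + N * (s2 - s1)) * ε ^ 2 * (1 / ε) ^ 2 = M + N * (s2 - s1) := by field_simp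
        rw [e]
        linarith)
      (j1.mono (prod_mono hst hsub)).neg
      (fun t ht x hx =>
        (j3 t (hst (Ioc_subset_Icc_self ht)) x (hsub (Ioo_subset_Icc_self hx))).2.2.2.2)
      (fun x hx => by
        have b1 := abs_le.1 (j4 (s1, y1) ⟨⟨le_rfl, h12⟩, hsub hy1m⟩)
        have b2 := j2 s1 hs1 (hsub hy1m) (hsub hx) (by have := hx.1; rw [hy0] at this; linarith)
        simp only [] at b1
        linarith)
      (fun t ht x hx => by
        have b1 := (j3 t (hst ht) x (hsub hx)).2.1
        have b2 : C * (-t) ^ (-α) ≤ M := by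
          apply mul_le_mul_of_nonneg_left _ hC
          exact Real.rpow_le_rpow_of_nonpos (by linarith) (by linarith [(hst ht).2]) (by linarith)
        linarith)
    have b1 := abs_le.1 (j4 (s2, y0) ⟨⟨h12, le_rfl⟩, hsub ⟨by linarith, by linarith⟩⟩)
    have b2 := ciInf_le hbdd y0
    simp only [] at b1 b2
    linarith
  have hcont : Continuous (fun ε : ℝ => g (s1, y1) + ε +
      (N + 4 * δ * ((M + N * (s2 - s1)) * ε ^ 2)) * (s2 - s1) + ε) := by fun_prop
  have hlim := (hcont.tendsto 0).mono_left (nhdsWithin_le_nhds (s := Ioi 0))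
  have := ge_of_tendsto hlim (by filter_upwards [self_mem_nhdsWithin] with ε hε using key ε hε)
  simp at this
  linarith

lemma Good.inf_mono {δ c₁ p α C : ℝ} {U V : ℕ → ℝ → ℝ → ℝ} (h : Good δ c₁ p α C U V)
    (hδ : 0 < δ) (hc₁ : 0 ≤ c₁) (hp : 0 < p) {δ' p' α' C' : ℝ} (h' : Good δ' c₁ p' α' C' V U)
    {g g' : ℝ × ℝ → ℝ} (hl : Lim U g) (hl' : Lim V g') {s1 s2 : ℝ} (h12 : s1 ≤ s2) (hs2 : s2 < 0) :
    (⨅ y, g (s1, y)) ≤ ⨅ y, g (s2, y) := by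
  refine le_ciInf fun y0 => ?_
  have hs10 : s1 < 0 := lt_of_le_of_lt h12 hs2
  have := h.grow hδ hc₁ hp hl hl' h12 hs2 le_rfl
    (fun y => ciInf_le (⟨0, by rintro _ ⟨y, rfl⟩; exact (h.bounds hl hs10 y).1⟩ :
      BddBelow (range fun y => g (s1, y))) y)
    (fun s hs y => (h'.bounds hl' (lt_of_le_of_lt hs.2 hs2) y).1) y0
  rw [Real.zero_rpow hp.ne'] at this
  simpa using this

lemma Good.inf_grow {δ c₁ p α C : ℝ} {U V : ℕ → ℝ → ℝ → ℝ} (h : Good δ c₁ p α C U V)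
    (hδ : 0 < δ) (hc₁ : 0 ≤ c₁) (hp : 0 < p) {δ' p' α' C' : ℝ} (h' : Good δ' c₁ p' α' C' V U)
    (hδ' : 0 < δ') (hp' : 0 < p')
    {g g' : ℝ × ℝ → ℝ} (hl : Lim U g) (hl' : Lim V g') {s1 s2 : ℝ} (h12 : s1 ≤ s2) (hs2 : s2 < 0) :
    (⨅ y, g (s1, y)) + c₁ * (⨅ y, g' (s1, y)) ^ p * (s2 - s1) ≤ ⨅ y, g (s2, y) := by
  refine le_ciInf fun y0 => ?_
  have hs10 : s1 < 0 := lt_of_le_of_lt h12 hs2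
  refine h.grow hδ hc₁ hp hl hl' h12 hs2 (le_ciInf fun y => (h'.bounds hl' hs10 y).1)
    (fun y => ciInf_le (⟨0, by rintro _ ⟨y, rfl⟩; exact (h.bounds hl hs10 y).1⟩ :
      BddBelow (range fun y => g (s1, y))) y)
    (fun s hs y => ?_) y0
  have hs0 : s < 0 := lt_of_le_of_lt hs.2 hs2
  refine (h'.inf_mono hδ' hc₁ hp' h hl' hl hs.1 hs0).trans ?_
  exact ciInf_le (⟨0, by rintro _ ⟨y, rfl⟩; exact (h'.bounds hl' hs0 y).1⟩ :
      BddBelow (range fun y => g' (s, y))) y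

lemma Good.inf_cont {δ c₁ p α C : ℝ} {U V : ℕ → ℝ → ℝ → ℝ} (h : Good δ c₁ p α C U V)
    (hδ : 0 < δ) (hc₁ : 0 ≤ c₁) (hp : 0 < p) (hα : 0 < α) (hC : 0 ≤ C)
    {δ' p' α' C' : ℝ} (h' : Good δ' c₁ p' α' C' V U)
    {g g' : ℝ × ℝ → ℝ} (hl : Lim U g) (hl' : Lim V g') :
    ContinuousOn (fun s => ⨅ y, g (s, y)) (Iio 0) := by
  intro s hs
  apply ContinuousAt.continuousWithinAt
  have hs0 : s < 0 := hs
  obtain ⟨N, hN, hup⟩ := h.upper hδ hα hC hl (2 * s) (s / 2) (by linarith)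
  rw [Metric.continuousAt_iff]
  intro ε hε
  refine ⟨min (-s / 2) (ε / (N + 1)), by
    apply lt_min
    · linarith
    · positivity, ?_⟩
  intro x hx
  rw [Real.dist_eq] at hx ⊢
  have hx1 := abs_lt.1 (lt_of_lt_of_le hx (min_le_left _ _))
  have hx2 := lt_of_lt_of_le hx (min_le_right _ _)
  have hxI : x ∈ Icc (2 * s) (s / 2) := ⟨by linarith, by linarith⟩
  have hsI : s ∈ Icc (2 * s) (s / 2) := ⟨by linarith, by linarith⟩
  have hN2 : N * |x - s| < ε := by
    rw [lt_div_iff₀ (by positivity)] at hx2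
    nlinarith [abs_nonneg (x - s)]
  rcases le_total s x with hsx | hsx
  · have a1 := hup s hsI x hxI hsx
    have a2 := h.inf_mono hδ hc₁ hp h' hl hl' hsx (by linarith [hxI.2])
    rw [abs_of_nonneg (by linarith : 0 ≤ x - s)] at hN2
    rw [abs_of_nonneg (by linarith)]; linarith
  · have a1 := hup x hxI s hsI hsx
    have a2 := h.inf_mono hδ hc₁ hp h' hl hl' hsx hs0
    rw [abs_of_nonpos (by linarith : x - s ≤ 0)] at hN2
    rw [abs_of_nonpos (by linarith)]; linarith


lemma exp_half_sq (σ : ℝ) : Real.exp (-(σ/2))^2 = Real.exp (-σ) := by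
  rw [sq, ← Real.exp_add]; congr 1; ring

lemma resc_pow {b p m σ x : ℝ} (hx : 0 ≤ x) (h : p*b = m) :
    (Real.exp (-(b*σ)) * x)^p = Real.exp (-(m*σ)) * x^p := by
  rw [Real.mul_rpow (Real.exp_pos _).le hx, ← Real.exp_mul, ← h]
  congr 2; ring

lemma resc_bd {α σ s T C f : ℝ} (hs : s < 0)
    (h : f ≤ C * (T - (T + Real.exp (-(σ/2))^2*s))^(-α)) :
    Real.exp (-(α*σ)) * f ≤ C * (-s)^(-α) := by
  have e : T - (T + Real.exp (-(σ/2))^2*s) = Real.exp (-σ) * (-s) := by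
    rw [exp_half_sq]; ring
  rw [e, Real.mul_rpow (Real.exp_pos _).le (by linarith), ← Real.exp_mul] at h
  have := mul_le_mul_of_nonneg_left h (Real.exp_pos (-(α*σ))).le
  refine this.trans (le_of_eq ?_)
  have e2 : Real.exp (-(α*σ)) * Real.exp (-σ * -α) = 1 := by
    rw [← Real.exp_add]; simp; ring
  calc _ = (Real.exp (-(α*σ)) * Real.exp (-σ * -α)) * (C * (-s)^(-α)) := by ring
    _ = _ := by rw [e2, one_mul]

set_option maxHeartbeats 1000000 in
lemma good_comp {δ β0 p r α β c₁ c₂ T R ρ₁ Cu Cv : ℝ} {u v : ℝ → ℝ → ℝ} {σs : ℕ → ℝ}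
    (hδ : 0 < δ) (hβ0 : 0 ≤ β0) (hp : 0 < p) (hr : 0 < r) (hα : 0 < α) (hβ : 0 < β)
    (hpb : p*β = α+1) (hra : r*α = α+1) (hc₂ : 0 < c₂)
    (hT : 0 < T) (hρ : ρ₁ ∈ Ioo (0:ℝ) R) (hCu : 0 ≤ Cu) (hCv : 0 ≤ Cv)
    (hu0 : ∀ t ∈ Ioo (0:ℝ) T, ∀ x ∈ Icc (ρ₁/2) R, 0 ≤ u t x)
    (hv0 : ∀ t ∈ Ioo (0:ℝ) T, ∀ x ∈ Icc (ρ₁/2) R, 0 ≤ v t x)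
    (hub : ∀ t ∈ Ioo (0:ℝ) T, ∀ x ∈ Icc (ρ₁/2) R, u t x ≤ Cu*(T-t)^(-α))
    (hvb : ∀ t ∈ Ioo (0:ℝ) T, ∀ x ∈ Icc (ρ₁/2) R, v t x ≤ Cv*(T-t)^(-β))
    (hcont : ContinuousOn (Function.uncurry u) (Ioo (0:ℝ) T ×ˢ Icc (ρ₁/2) R))
    (hanti : ∀ t ∈ Ioo (0:ℝ) T, AntitoneOn (u t) (Icc (ρ₁/2) R))
    (hs1 : ∀ t ∈ Ioo (0:ℝ) T, ∀ x ∈ Ico (ρ₁/2) R, SupAt δ β0 (c₁ * v t x ^ p) u t x)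
    (hs2 : ∀ t ∈ Ioo (0:ℝ) T, ∀ x ∈ Ico (ρ₁/2) R,
      SupAt δ β0 (-(c₂*(v t x ^ p + u t x ^ r + 1))) (fun t x => - u t x) t x)
    (hσ : Tendsto σs atTop atTop) :
    Good δ c₁ p α Cu
      (fun j s y => Real.exp (-(α*σs j)) * u (T + Real.exp (-(σs j/2))^2*s) (ρ₁ + Real.exp (-(σs j/2))*y))
      (fun j s y => Real.exp (-(β*σs j)) * v (T + Real.exp (-(σs j/2))^2*s) (ρ₁ + Real.exp (-(σs j/2))*y)) := by
  intro sa sb hsb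
  have hNu : 0 ≤ Cu*(-sb)^(-α) := mul_nonneg hCu (Real.rpow_nonneg (by linarith) _)
  have hNv : 0 ≤ Cv*(-sb)^(-β) := mul_nonneg hCv (Real.rpow_nonneg (by linarith) _)
  refine ⟨c₂*((Cv*(-sb)^(-β))^p + (Cu*(-sb)^(-α))^r + 1), ?_, ?_⟩
  · have := Real.rpow_nonneg hNv p
    have := Real.rpow_nonneg hNu r
    positivity
  intro L ε hε
  have ha : Tendsto (fun j => Real.exp (-(σs j/2))) atTop (nhds 0) :=
    Real.tendsto_exp_neg_atTop_nhds_zero.comp (hσ.atTop_div_const two_pos)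
  have ha2 : Tendsto (fun j => Real.exp (-(σs j/2))^2*sa) atTop (nhds 0) := by
    simpa using (ha.pow 2).mul_const sa
  have haL : Tendsto (fun j => Real.exp (-(σs j/2))*|L|) atTop (nhds 0) := by
    simpa using ha.mul_const |L|
  have hab : Tendsto (fun j => Real.exp (-(σs j/2))*β0) atTop (nhds 0) := by
    simpa using ha.mul_const β0
  have hm : 0 < min (ρ₁/2) (R-ρ₁) := lt_min (by linarith [hρ.1]) (by linarith [hρ.2])
  filter_upwards [ha2.eventually (lt_mem_nhds (show -T < 0 by linarith)),
    haL.eventually (gt_mem_nhds hm), hab.eventually (gt_mem_nhds hε), hσ.eventually_ge_atTop 0]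
    with j h1 h2 h3 h4
  set a := Real.exp (-(σs j/2)) with hadef
  have hapos : 0 < a := Real.exp_pos _
  have htm : ∀ s ∈ Icc sa sb, T + a^2*s ∈ Ioo (0:ℝ) T := by
    intro s hs
    have : a^2*sa ≤ a^2*s := mul_le_mul_of_nonneg_left hs.1 (by positivity)
    have : a^2*s < 0 := mul_neg_of_pos_of_neg (by positivity) (by linarith [hs.2])
    constructor <;> linarith
  have hxm : ∀ y ∈ Icc (-L) L, ρ₁ + a*y ∈ Ico (ρ₁/2) R := by
    intro y hy
    have hy' : |y| ≤ |L| := (abs_le.2 hy).trans (le_abs_self L)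
    have h5 : |a*y| ≤ a*|L| := by
      rw [abs_mul, abs_of_pos hapos]; exact mul_le_mul_of_nonneg_left hy' hapos.le
    have h6 := abs_le.1 h5
    have h7 := lt_min_iff.1 h2
    constructor <;> linarith [h6.1, h6.2, h7.1, h7.2]
  refine ⟨?_, ?_, ?_⟩
  · have hmap : MapsTo (fun x : ℝ×ℝ => (T + a^2*x.1, ρ₁ + a*x.2)) (Icc sa sb ×ˢ Icc (-L) L)
        (Ioo (0:ℝ) T ×ˢ Icc (ρ₁/2) R) := fun x hx =>
      ⟨htm _ hx.1, Ico_subset_Icc_self (hxm _ hx.2)⟩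
    have := hcont.comp (f := fun x : ℝ×ℝ => (T + a^2*x.1, ρ₁ + a*x.2)) (by fun_prop) hmap
    exact continuousOn_const.mul this
  · intro s hs y1 hy1 y2 hy2 h12
    refine mul_le_mul_of_nonneg_left ?_ (Real.exp_pos _).le
    refine hanti _ (htm s hs) (Ico_subset_Icc_self (hxm _ hy1)) (Ico_subset_Icc_self (hxm _ hy2)) ?_
    have := mul_le_mul_of_nonneg_left h12 hapos.le
    linarith
  · intro s hs y hy
    have ht := htm s hs
    have hx := hxm y hy
    have hx' := Ico_subset_Icc_self hx
    have hs0 : s < 0 := by linarith [hs.2]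
    have hu := hu0 _ ht _ hx'
    have hv := hv0 _ ht _ hx'
    have bu := resc_bd (α := α) (σ := σs j) hs0 (hub _ ht _ hx')
    have bv := resc_bd (α := β) (σ := σs j) hs0 (hvb _ ht _ hx')
    have hU0 := mul_nonneg (Real.exp_pos (-(α*σs j))).le hu
    have hV0 := mul_nonneg (Real.exp_pos (-(β*σs j))).le hv
    have ek : Real.exp (-(α*σs j)) * a^2 = Real.exp (-((α+1)*σs j)) := by
      rw [hadef, exp_half_sq, ← Real.exp_add]; congr 1; ring
    have eV := resc_pow (σ := σs j) hv hpb
    have eU := resc_pow (σ := σs j) hu hra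
    have mono : ∀ γ : ℝ, 0 < γ → (-s)^(-γ) ≤ (-sb)^(-γ) := fun γ hγ =>
      Real.rpow_le_rpow_of_nonpos (by linarith) (by linarith [hs.2]) (by linarith)
    refine ⟨hU0, bu, hV0, ?_, ?_⟩
    · have := (hs1 _ ht _ hx).scale hapos (Real.exp_pos (-(α*σs j)))
      refine this.mono hδ.le h3.le (le_of_eq ?_)
      rw [eV, ek]; ring
    · have := (hs2 _ ht _ hx).scale hapos (Real.exp_pos (-(α*σs j)))
      have e : (fun s y => Real.exp (-(α*σs j)) * (fun t x => - u t x) (T + a^2*s) (ρ₁ + a*y))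
        = fun s y => -(Real.exp (-(α*σs j)) * u (T + a^2*s) (ρ₁ + a*y)) := by
        funext s y; simp
      rw [e] at this
      refine this.mono hδ.le h3.le ?_
      rw [ek]
      have k1 : Real.exp (-((α+1)*σs j)) * v (T + a^2*s) (ρ₁ + a*y) ^ p ≤ (Cv*(-sb)^(-β))^p := by
        rw [← eV]
        exact Real.rpow_le_rpow hV0 (bv.trans (mul_le_mul_of_nonneg_left (mono β hβ) hCv)) hp.le
      have k2 : Real.exp (-((α+1)*σs j)) * u (T + a^2*s) (ρ₁ + a*y) ^ r ≤ (Cu*(-sb)^(-α))^r := by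
        rw [← eU]
        exact Real.rpow_le_rpow hU0 (bu.trans (mul_le_mul_of_nonneg_left (mono α hα) hCu)) hr.le
      have k3 : Real.exp (-((α+1)*σs j)) ≤ 1 := by
        rw [Real.exp_le_one_iff]
        have : 0 ≤ (α+1)*σs j := by positivity
        linarith
      have := mul_le_mul_of_nonneg_left (add_le_add (add_le_add k1 k2) k3) hc₂.le
      nlinarith [this]

/-- limits in the similarity variables -/
lemma unif_comp {α T ρ₁ : ℝ} {u : ℝ → ℝ → ℝ} {τ : ℕ → ℝ} {g : ℝ × ℝ → ℝ}
    (hl : Lim (fun j s y => Real.exp (-(α*τ j)) * u (T + Real.exp (-(τ j/2))^2*s)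
      (ρ₁ + Real.exp (-(τ j/2))*y)) g) (S : Set (ℝ × ℝ)) (hS : Bornology.IsBounded S) :
    TendstoUniformlyOn (fun j (x : ℝ × ℝ) => Real.exp (-(α*(x.1 + τ j))) *
      u (T - Real.exp (-(x.1 + τ j))) (ρ₁ + x.2 * Real.exp (-((x.1 + τ j)/2))))
      (Function.uncurry fun σ θ => Real.exp (-(α*σ)) * g (-Real.exp (-σ), θ * Real.exp (-(σ/2))))
      atTop S := by
  have hK : IsCompact (closure S) := hS.isCompact_closure
  have hf : Continuous (fun x : ℝ × ℝ => (-Real.exp (-x.1), x.2 * Real.exp (-(x.1/2)))) := by fun_prop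
  obtain ⟨M, hM⟩ := hK.exists_bound_of_continuousOn (f := fun x : ℝ×ℝ => Real.exp (-(α*x.1)))
    (by fun_prop)
  rw [Metric.tendstoUniformlyOn_iff]
  intro ε hε
  have hM' : 0 < |M| + 1 := by positivity
  have := hl _ (by
    rintro _ ⟨x, _, rfl⟩
    exact ⟨by simpa using Real.exp_pos _, trivial⟩) (hK.image hf) (ε/(2*(|M|+1))) (by positivity)
  filter_upwards [this] with j hj x hx
  have hx' := subset_closure hx
  have h1 := hj _ ⟨x, hx', rfl⟩
  have h2 := hM x hx'
  rw [Real.norm_eq_abs, abs_of_pos (Real.exp_pos _)] at h2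
  have e : Real.exp (-(α*(x.1 + τ j))) *
      u (T - Real.exp (-(x.1 + τ j))) (ρ₁ + x.2 * Real.exp (-((x.1 + τ j)/2)))
      = Real.exp (-(α*x.1)) * (Real.exp (-(α*τ j)) * u (T + Real.exp (-(τ j/2))^2*(-Real.exp (-x.1)))
      (ρ₁ + Real.exp (-(τ j/2))*(x.2 * Real.exp (-(x.1/2))))) := by
    rw [exp_half_sq, ← mul_assoc, ← Real.exp_add]
    have e1 : T - Real.exp (-(x.1 + τ j)) = T + Real.exp (-τ j) * -Real.exp (-x.1) := by
      rw [mul_neg, ← Real.exp_add, ← sub_eq_add_neg]; congr 2; ring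
    have e2 : x.2 * Real.exp (-((x.1 + τ j)/2)) = Real.exp (-(τ j/2))*(x.2 * Real.exp (-(x.1/2))) := by
      rw [mul_left_comm, ← Real.exp_add]; congr 2; ring
    rw [e1, e2]; congr 2; ring
  rw [e, dist_comm, Real.dist_eq, Function.uncurry_def]
  simp only []
  rw [← mul_sub, abs_mul, abs_of_pos (Real.exp_pos _)]
  calc _ ≤ (|M|+1) * (ε/(2*(|M|+1))) :=
        mul_le_mul (by linarith [le_abs_self M]) h1 (abs_nonneg _) hM'.le
    _ = ε/2 := by field_simp
    _ < ε := by linarith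

lemma exp_pow_cancel {α σ : ℝ} : Real.exp (-(α*σ)) * (- -Real.exp (-σ))^(-α) = 1 := by
  rw [neg_neg, ← Real.exp_mul, ← Real.exp_add]; simp; ring

set_option maxHeartbeats 1000000 in
lemma final_part {δ δ' c₁ p p' α α' C C' : ℝ} {U V : ℕ → ℝ → ℝ → ℝ} {g g' : ℝ × ℝ → ℝ}
    (h : Good δ c₁ p α C U V) (hδ : 0 < δ) (hc₁ : 0 ≤ c₁) (hp : 1 < p) (hα : 0 < α) (hC : 0 ≤ C)
    (h' : Good δ' c₁ p' α' C' V U) (hδ' : 0 < δ') (hp' : 1 < p') (hpa : p*α' = α+1)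
    (hα' : 0 < α') (hC' : 0 ≤ C')
    (hl : Lim U g) (hl' : Lim V g') :
    (∀ σ : ℝ, Antitone (fun θ => Real.exp (-(α*σ)) * g (-Real.exp (-σ), θ * Real.exp (-(σ/2)))) ∧
      Tendsto (fun θ => Real.exp (-(α*σ)) * g (-Real.exp (-σ), θ * Real.exp (-(σ/2)))) atTop
        (nhds (Real.exp (-(α*σ)) * ⨅ y, g (-Real.exp (-σ), y)))) ∧
    Continuous (fun σ => Real.exp (-(α*σ)) * ⨅ y, g (-Real.exp (-σ), y)) ∧
    (∀ σ, 0 ≤ Real.exp (-(α*σ)) * ⨅ y, g (-Real.exp (-σ), y)) ∧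
    (∀ σ, Real.exp (-(α*σ)) * (⨅ y, g (-Real.exp (-σ), y)) ≤ C) ∧
    (∀ σ, ∀ t ≥ 0, c₁ * (Real.exp (-(α'*σ)) * ⨅ y, g' (-Real.exp (-σ), y))^p * (1 - Real.exp (-t))
      ≤ (Real.exp (-(α*(σ+t))) * ⨅ y, g (-Real.exp (-(σ+t)), y)) * Real.exp (α*t)
        - Real.exp (-(α*σ)) * ⨅ y, g (-Real.exp (-σ), y)) := by
  have hneg : ∀ σ : ℝ, -Real.exp (-σ) < 0 := fun σ => by simpa using Real.exp_pos _
  have hbdd : ∀ σ : ℝ, BddBelow (range fun y => g (-Real.exp (-σ), y)) := fun σ =>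
    ⟨0, by rintro _ ⟨y, rfl⟩; exact (h.bounds hl (hneg σ) y).1⟩
  have hcont := h.inf_cont hδ hc₁ (by linarith) hα hC h' hl hl'
  refine ⟨fun σ => ⟨?_, ?_⟩, ?_, ?_, ?_, ?_⟩
  · intro y1 y2 h12
    refine mul_le_mul_of_nonneg_left ?_ (Real.exp_pos _).le
    exact h.anti hl (hneg σ) (mul_le_mul_of_nonneg_right h12 (Real.exp_pos _).le)
  · refine Tendsto.const_mul _ ?_
    exact (tendsto_atTop_ciInf (h.anti hl (hneg σ)) (hbdd σ)).comp
      (tendsto_id.atTop_mul_const (Real.exp_pos (-(σ/2))))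
  · refine Continuous.mul (by fun_prop) ?_
    exact hcont.comp_continuous (f := fun σ => -Real.exp (-σ)) (by fun_prop) (fun σ => hneg σ)
  · intro σ
    exact mul_nonneg (Real.exp_pos _).le (Real.iInf_nonneg fun y => (h.bounds hl (hneg σ) y).1)
  · intro σ
    have h1 : (⨅ y, g (-Real.exp (-σ), y)) ≤ C * (- -Real.exp (-σ))^(-α) :=
      (ciInf_le (hbdd σ) 0).trans (h.bounds hl (hneg σ) 0).2
    refine (mul_le_mul_of_nonneg_left h1 (Real.exp_pos (-(α*σ))).le).trans (le_of_eq ?_)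
    rw [mul_left_comm, exp_pow_cancel, mul_one]
  · intro σ t ht
    have h12 : -Real.exp (-σ) ≤ -Real.exp (-(σ+t)) := by
      rw [neg_le_neg_iff, Real.exp_le_exp]; linarith
    have h1 := h.inf_grow hδ hc₁ (by linarith) h' hδ' (by linarith) hl hl' h12 (hneg _)
    have hψ : 0 ≤ ⨅ y, g' (-Real.exp (-σ), y) := Real.iInf_nonneg fun y => (h'.bounds hl' (hneg σ) y).1
    rw [resc_pow hψ hpa]
    have e1 : Real.exp (-(α*(σ+t))) * Real.exp (α*t) = Real.exp (-(α*σ)) := by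
      rw [← Real.exp_add]; congr 1; ring
    have e2 : Real.exp (-((α+1)*σ)) * (1 - Real.exp (-t))
        = Real.exp (-(α*σ)) * (-Real.exp (-(σ+t)) - -Real.exp (-σ)) := by
      have : Real.exp (-((α+1)*σ)) = Real.exp (-(α*σ)) * Real.exp (-σ) := by
        rw [← Real.exp_add]; congr 1; ring
      have h3 : Real.exp (-(σ+t)) = Real.exp (-σ) * Real.exp (-t) := by
        rw [← Real.exp_add]; congr 1; ring
      rw [this, h3]; ring
    have h2 := mul_le_mul_of_nonneg_left h1 (Real.exp_pos (-(α*σ))).le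
    have e3 : (Real.exp (-(α*(σ+t))) * ⨅ y, g (-Real.exp (-(σ+t)), y)) * Real.exp (α*t)
        = Real.exp (-(α*σ)) * ⨅ y, g (-Real.exp (-(σ+t)), y) := by
      rw [← e1]; ring
    rw [e3]
    have e4 : ∀ X : ℝ, c₁ * (Real.exp (-((α+1)*σ)) * X) * (1 - Real.exp (-t))
       = Real.exp (-(α*σ)) * (c₁ * X * (-Real.exp (-(σ+t)) - -Real.exp (-σ))) := by
      intro X
      calc _ = c₁ * X * (Real.exp (-((α+1)*σ)) * (1 - Real.exp (-t))) := by ring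
        _ = _ := by rw [e2]; ring
    rw [e4]
    rw [mul_add] at h2
    linarith


/-- Convergence of rescaled solutions (in similarity variables around `(T, ρ₁)`,
`W(σ,θ) = (T-t)^α u(t,ρ)`, `Z(σ,θ) = (T-t)^β v(t,ρ)` with `t = T - e^{-σ}`,
`ρ = ρ₁ + θ e^{-σ/2}`) to a bounded continuous nonnegative distributional solution
`(φ, ψ)` of the system of ordinary differential inequalities
`φ' + αφ ≥ c₁ ψ^p`, `ψ' + βψ ≥ c₁ φ^q` on `ℝ`: along a subsequence of any
sequence `σ_j → ∞`, the time-translates of `(W,Z)` converge uniformly on bounded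
sets to `(w,z)`, which are nonincreasing in `θ`, and `φ(σ) = lim_{θ→∞} w(σ,θ)`,
`ψ(σ) = lim_{θ→∞} z(σ,θ)`. -/
theorem rescaled_solutions_converge_to_ODI
    (n : ℕ) (hn : 1 ≤ n) (R : ℝ) (hR : 0 < R)
    (p q δ : ℝ) (hp : 1 < p) (hq : 1 < q) (hδ : 0 < δ)
    (c₁ c₂ : ℝ) (hc₁ : 0 < c₁) (hc₂ : 0 < c₂)
    (T : ℝ) (hT : 0 < T)
    (F G : ℝ → ℝ → ℝ)
    (hF_C1 : ContDiff ℝ 1 (Function.uncurry F))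
    (hG_C1 : ContDiff ℝ 1 (Function.uncurry G))
    (hFv : ∀ a b : ℝ, 0 ≤ a → 0 ≤ b → 0 ≤ deriv (fun y => F a y) b)
    (hGu : ∀ a b : ℝ, 0 ≤ a → 0 ≤ b → 0 ≤ deriv (fun x => G x b) a)
    (hF_low : ∀ a b : ℝ, 0 ≤ a → 0 ≤ b → c₁ * b ^ p ≤ F a b)
    (hF_up : ∀ a b : ℝ, 0 ≤ a → 0 ≤ b →
      F a b ≤ c₂ * (b ^ p + a ^ (p * (q + 1) / (p + 1)) + 1))
    (hG_low : ∀ a b : ℝ, 0 ≤ a → 0 ≤ b → c₁ * a ^ q ≤ G a b)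
    (hG_up : ∀ a b : ℝ, 0 ≤ a → 0 ≤ b →
      G a b ≤ c₂ * (a ^ q + b ^ (q * (p + 1) / (q + 1)) + 1))
    (u v : ℝ → ℝ → ℝ)
    (hu_nn : ∀ t ∈ Ico (0:ℝ) T, ∀ ρ ∈ Icc (0:ℝ) R, 0 ≤ u t ρ)
    (hv_nn : ∀ t ∈ Ico (0:ℝ) T, ∀ ρ ∈ Icc (0:ℝ) R, 0 ≤ v t ρ)
    (hu_cont : ContinuousOn (Function.uncurry u) (Ico (0:ℝ) T ×ˢ Icc (0:ℝ) R))
    (hv_cont : ContinuousOn (Function.uncurry v) (Ico (0:ℝ) T ×ˢ Icc (0:ℝ) R))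
    (hu_regx : ∀ t ∈ Ioo (0:ℝ) T, ContDiffOn ℝ 2 (u t) (Ioo (0:ℝ) R))
    (hv_regx : ∀ t ∈ Ioo (0:ℝ) T, ContDiffOn ℝ 2 (v t) (Ioo (0:ℝ) R))
    (hu_regt : ∀ ρ ∈ Ioo (0:ℝ) R, ∀ t ∈ Ioo (0:ℝ) T, DifferentiableAt ℝ (fun s => u s ρ) t)
    (hv_regt : ∀ ρ ∈ Ioo (0:ℝ) R, ∀ t ∈ Ioo (0:ℝ) T, DifferentiableAt ℝ (fun s => v s ρ) t)
    (hu_bc : ∀ t ∈ Ioo (0:ℝ) T, u t R = 0)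
    (hv_bc : ∀ t ∈ Ioo (0:ℝ) T, v t R = 0)
    (hu_mono : ∀ t ∈ Ico (0:ℝ) T, AntitoneOn (u t) (Icc (0:ℝ) R))
    (hv_mono : ∀ t ∈ Ico (0:ℝ) T, AntitoneOn (v t) (Icc (0:ℝ) R))
    (hu_pde : ∀ t ∈ Ioo (0:ℝ) T, ∀ ρ ∈ Ioo (0:ℝ) R,
      deriv (fun s => u s ρ) t
        = δ * (deriv (deriv (u t)) ρ + ((n : ℝ) - 1) / ρ * deriv (u t) ρ)
          + F (u t ρ) (v t ρ))
    (hv_pde : ∀ t ∈ Ioo (0:ℝ) T, ∀ ρ ∈ Ioo (0:ℝ) R,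
      deriv (fun s => v s ρ) t
        = deriv (deriv (v t)) ρ + ((n : ℝ) - 1) / ρ * deriv (v t) ρ
          + G (u t ρ) (v t ρ))
    (ρ₁ : ℝ) (hρ₁ : ρ₁ ∈ Ioo (0:ℝ) R)
    (W Z : ℝ → ℝ → ℝ)
    (hW : W = fun σ θ => Real.exp (-(((p + 1) / (p * q - 1)) * σ)) *
      u (T - Real.exp (-σ)) (ρ₁ + θ * Real.exp (-(σ / 2))))
    (hZ : Z = fun σ θ => Real.exp (-(((q + 1) / (p * q - 1)) * σ)) *
      v (T - Real.exp (-σ)) (ρ₁ + θ * Real.exp (-(σ / 2)))) :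
    ∀ σs : ℕ → ℝ, Tendsto σs atTop atTop →
      ∃ k : ℕ → ℕ, StrictMono k ∧
      ∃ w z : ℝ → ℝ → ℝ, ∃ φ ψ : ℝ → ℝ,
        (∀ S : Set (ℝ × ℝ), Bornology.IsBounded S →
          TendstoUniformlyOn (fun j x => W (x.1 + σs (k j)) x.2)
            (Function.uncurry w) atTop S ∧
          TendstoUniformlyOn (fun j x => Z (x.1 + σs (k j)) x.2)
            (Function.uncurry z) atTop S) ∧
        (∀ σ : ℝ, Antitone (w σ) ∧ Antitone (z σ) ∧
          Tendsto (w σ) atTop (nhds (φ σ)) ∧ Tendsto (z σ) atTop (nhds (ψ σ))) ∧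
        Continuous φ ∧ Continuous ψ ∧
        (∃ B : ℝ, ∀ σ : ℝ, |φ σ| ≤ B ∧ |ψ σ| ≤ B) ∧
        (∀ σ : ℝ, 0 ≤ φ σ ∧ 0 ≤ ψ σ) ∧
        (∀ ξ : ℝ → ℝ, ContDiff ℝ (⊤ : ℕ∞) ξ → HasCompactSupport ξ →
          (∀ x, 0 ≤ ξ x) →
          c₁ * ∫ σ : ℝ, ψ σ ^ p * ξ σ
              ≤ ∫ σ : ℝ, (-(φ σ) * deriv ξ σ
                  + (p + 1) / (p * q - 1) * φ σ * ξ σ) ∧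
          c₁ * ∫ σ : ℝ, φ σ ^ q * ξ σ
              ≤ ∫ σ : ℝ, (-(ψ σ) * deriv ξ σ
                  + (q + 1) / (p * q - 1) * ψ σ * ξ σ)) := by
  intro σs hσ
  obtain ⟨hρ0, hρR⟩ := hρ₁
  have hpq : 0 < p*q - 1 := by nlinarith
  have hpq' : p*q - 1 ≠ 0 := hpq.ne'
  have hpq2 : q*p - 1 ≠ 0 := by rw [mul_comm]; exact hpq'
  obtain ⟨α, hαd⟩ : ∃ α, α = (p+1)/(p*q-1) := ⟨_, rfl⟩
  obtain ⟨β, hβd⟩ : ∃ β, β = (q+1)/(p*q-1) := ⟨_, rfl⟩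
  obtain ⟨r, hrd⟩ : ∃ r, r = p*(q+1)/(p+1) := ⟨_, rfl⟩
  obtain ⟨s, hsd⟩ : ∃ s, s = q*(p+1)/(q+1) := ⟨_, rfl⟩
  have hα : 0 < α := by rw [hαd]; positivity
  have hβ : 0 < β := by rw [hβd]; positivity
  have hr : 0 < r := by rw [hrd]; positivity
  have hs : 0 < s := by rw [hsd]; positivity
  have hp1 : p + 1 ≠ 0 := by positivity
  have hq1 : q + 1 ≠ 0 := by positivity
  have e1 : p*β = α+1 := by rw [hαd, hβd]; field_simp; ring
  have e2 : q*α = β+1 := by rw [hαd, hβd]; field_simp; ring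
  have e3 : r*α = α+1 := by rw [hαd, hrd]; field_simp; ring
  have e4 : s*β = β+1 := by rw [hβd, hsd]; field_simp; ring
  simp only [← hαd, ← hβd, ← hrd, ← hsd] at hF_up hG_up hW hZ ⊢
  have hn' : (0:ℝ) ≤ (n:ℝ) - 1 := by
    have : (1:ℝ) ≤ n := by exact_mod_cast hn
    linarith
  obtain ⟨β0, hβ0d⟩ : ∃ β0, β0 = ((n:ℝ)-1)*(4/ρ₁) := ⟨_, rfl⟩
  have hβ0 : 0 ≤ β0 := by rw [hβ0d]; positivity
  have hb : ∀ x, ρ₁/4 ≤ x → |((n:ℝ)-1)/x| ≤ β0 := by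
    intro x hx
    have hx0 : 0 < x := by linarith
    rw [abs_of_nonneg (by positivity), hβ0d, div_eq_mul_one_div]
    refine mul_le_mul_of_nonneg_left ?_ hn'
    rw [div_le_div_iff₀ hx0 hρ0]; linarith
  have hmem : ∀ x, ρ₁/4 ≤ x → x < R → x ∈ Ioo (0:ℝ) R := fun x h1 h2 => ⟨by linarith, h2⟩
  have S1 : ∀ t ∈ Ioo (0:ℝ) T, ∀ x, ρ₁/4 ≤ x → x < R → SupAt δ β0 (c₁ * v t x ^ p) u t x := by
    intro t ht x h1 h2
    have hx := hmem x h1 h2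
    have ht' := Ioo_subset_Ico_self ht
    refine supAt_of_pde hδ.le (hu_regx t ht) hx (hu_regt x hx t ht) (hb x h1) ?_
    rw [hu_pde t ht x hx]
    have := hF_low _ _ (hu_nn t ht' x (Ioo_subset_Icc_self hx)) (hv_nn t ht' x (Ioo_subset_Icc_self hx))
    linarith
  have S2 : ∀ t ∈ Ioo (0:ℝ) T, ∀ x, ρ₁/4 ≤ x → x < R → SupAt 1 β0 (c₁ * u t x ^ q) v t x := by
    intro t ht x h1 h2
    have hx := hmem x h1 h2
    have ht' := Ioo_subset_Ico_self ht
    refine supAt_of_pde zero_le_one (hv_regx t ht) hx (hv_regt x hx t ht) (hb x h1) ?_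
    rw [hv_pde t ht x hx]
    have := hG_low _ _ (hu_nn t ht' x (Ioo_subset_Icc_self hx)) (hv_nn t ht' x (Ioo_subset_Icc_self hx))
    linarith
  have dneg : ∀ f : ℝ → ℝ, deriv (fun x => - f x) = fun x => - deriv f x := by
    intro f; funext x; exact deriv.fun_neg
  have S3 : ∀ t ∈ Ioo (0:ℝ) T, ∀ x, ρ₁/4 ≤ x → x < R →
      SupAt δ β0 (-(c₂*(v t x ^ p + u t x ^ r + 1))) (fun t x => - u t x) t x := by
    intro t ht x h1 h2
    have hx := hmem x h1 h2
    have ht' := Ioo_subset_Ico_self ht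
    refine supAt_of_pde hδ.le (hu_regx t ht).neg hx (hu_regt x hx t ht).neg (hb x h1) ?_
    have := hF_up _ _ (hu_nn t ht' x (Ioo_subset_Icc_self hx)) (hv_nn t ht' x (Ioo_subset_Icc_self hx))
    simp only [dneg]
    rw [hu_pde t ht x hx]
    linarith
  have S4 : ∀ t ∈ Ioo (0:ℝ) T, ∀ x, ρ₁/4 ≤ x → x < R →
      SupAt 1 β0 (-(c₂*(u t x ^ q + v t x ^ s + 1))) (fun t x => - v t x) t x := by
    intro t ht x h1 h2
    have hx := hmem x h1 h2
    have ht' := Ioo_subset_Ico_self ht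
    refine supAt_of_pde zero_le_one (hv_regx t ht).neg hx (hv_regt x hx t ht).neg (hb x h1) ?_
    have := hG_up _ _ (hu_nn t ht' x (Ioo_subset_Icc_self hx)) (hv_nn t ht' x (Ioo_subset_Icc_self hx))
    simp only [dneg]
    rw [hv_pde t ht x hx]
    linarith
  have hI : ∀ x ∈ Icc (3*ρ₁/8 - ρ₁/8) (3*ρ₁/8 + ρ₁/8), ρ₁/4 ≤ x ∧ x ≤ ρ₁/2 := fun x hx =>
    ⟨by linarith [hx.1], by linarith [hx.2]⟩
  have hI' : Icc (3*ρ₁/8 - ρ₁/8) (3*ρ₁/8 + ρ₁/8) ⊆ Icc 0 R := fun x hx =>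
    ⟨by linarith [(hI x hx).1], by linarith [(hI x hx).2]⟩
  have hsub1 := prod_mono (Subset.refl (Ico (0:ℝ) T)) hI'
  obtain ⟨Cu, hCu, hCu'⟩ := typeI (c := 3*ρ₁/8) (L0 := ρ₁/8) hδ one_pos hβ0 hp hq hc₁ (by linarith) hT
    (hu_cont.mono hsub1) (hv_cont.mono hsub1)
    (fun t ht x hx => hu_nn t ht x (hI' hx)) (fun t ht x hx => hv_nn t ht x (hI' hx))
    (fun t ht x hx => S1 t ht x (hI x hx).1 (by linarith [(hI x hx).2]))
    (fun t ht x hx => S2 t ht x (hI x hx).1 (by linarith [(hI x hx).2]))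
  obtain ⟨Cv, hCv, hCv'⟩ := typeI (c := 3*ρ₁/8) (L0 := ρ₁/8) one_pos hδ hβ0 hq hp hc₁ (by linarith) hT
    (hv_cont.mono hsub1) (hu_cont.mono hsub1)
    (fun t ht x hx => hv_nn t ht x (hI' hx)) (fun t ht x hx => hu_nn t ht x (hI' hx))
    (fun t ht x hx => S2 t ht x (hI x hx).1 (by linarith [(hI x hx).2]))
    (fun t ht x hx => S1 t ht x (hI x hx).1 (by linarith [(hI x hx).2]))
  rw [← hαd] at hCu'
  rw [mul_comm q p, ← hβd] at hCv'
  have hJ : Icc (ρ₁/2) R ⊆ Icc 0 R := fun x hx => ⟨by linarith [hx.1], hx.2⟩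
  have hub : ∀ t ∈ Ioo (0:ℝ) T, ∀ x ∈ Icc (ρ₁/2) R, u t x ≤ Cu*(T-t)^(-α) := by
    intro t ht x hx
    have ht' := Ioo_subset_Ico_self ht
    refine hCu' t ht' _ fun y hy => hu_mono t ht' (hI' hy) (hJ hx) ?_
    linarith [(hI y hy).2, hx.1]
  have hvb : ∀ t ∈ Ioo (0:ℝ) T, ∀ x ∈ Icc (ρ₁/2) R, v t x ≤ Cv*(T-t)^(-β) := by
    intro t ht x hx
    have ht' := Ioo_subset_Ico_self ht
    refine hCv' t ht' _ fun y hy => hv_mono t ht' (hI' hy) (hJ hx) ?_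
    linarith [(hI y hy).2, hx.1]
  have hu0 : ∀ t ∈ Ioo (0:ℝ) T, ∀ x ∈ Icc (ρ₁/2) R, 0 ≤ u t x := fun t ht x hx =>
    hu_nn t (Ioo_subset_Ico_self ht) x (hJ hx)
  have hv0 : ∀ t ∈ Ioo (0:ℝ) T, ∀ x ∈ Icc (ρ₁/2) R, 0 ≤ v t x := fun t ht x hx =>
    hv_nn t (Ioo_subset_Ico_self ht) x (hJ hx)
  have hsub2 := prod_mono (Ioo_subset_Ico_self (a := (0:ℝ)) (b := T)) hJ
  have G1 := good_comp (σs := σs) hδ hβ0 (by linarith) hr hα hβ e1 e3 hc₂ hT ⟨hρ0, hρR⟩ hCu.le hCv.le hu0 hv0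
    hub hvb (hu_cont.mono hsub2)
    (fun t ht => (hu_mono t (Ioo_subset_Ico_self ht)).mono hJ)
    (fun t ht x hx => S1 t ht x (by linarith [hx.1]) hx.2)
    (fun t ht x hx => S3 t ht x (by linarith [hx.1]) hx.2) hσ
  have G2 := good_comp (σs := σs) one_pos hβ0 (by linarith) hs hβ hα e2 e4 hc₂ hT ⟨hρ0, hρR⟩ hCv.le hCu.le hv0 hu0
    hvb hub (hv_cont.mono hsub2)
    (fun t ht => (hv_mono t (Ioo_subset_Ico_self ht)).mono hJ)
    (fun t ht x hx => S2 t ht x (by linarith [hx.1]) hx.2)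
    (fun t ht x hx => S4 t ht x (by linarith [hx.1]) hx.2) hσ
  obtain ⟨k1, hk1, g, hg⟩ := G1.lim hδ hc₁.le hα hCu.le
  have G1' := G1.sub hk1
  have G2' := G2.sub hk1
  obtain ⟨k2, hk2, g', hg'⟩ := G2'.lim one_pos hc₁.le hβ hCv.le
  have G1'' := G1'.sub hk2
  have G2'' := G2'.sub hk2
  have hg2 := hg.sub hk2
  obtain ⟨a1, a2, a3, a4, a5⟩ := final_part G1'' hδ hc₁.le hp hα hCu.le G2'' one_pos hq e1 hβ hCv.le hg2 hg'
  obtain ⟨b1, b2, b3, b4, b5⟩ := final_part G2'' one_pos hc₁.le hq hβ hCv.le G1'' hδ hp e2 hα hCu.le hg' hg2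
  refine ⟨fun j => k1 (k2 j), hk1.comp hk2,
    fun σ θ => Real.exp (-(α*σ)) * g (-Real.exp (-σ), θ * Real.exp (-(σ/2))),
    fun σ θ => Real.exp (-(β*σ)) * g' (-Real.exp (-σ), θ * Real.exp (-(σ/2))),
    fun σ => Real.exp (-(α*σ)) * ⨅ y, g (-Real.exp (-σ), y),
    fun σ => Real.exp (-(β*σ)) * ⨅ y, g' (-Real.exp (-σ), y), ?_, ?_, a2, b2, ?_, ?_, ?_⟩
  · intro S hS
    rw [hW, hZ]
    exact ⟨unif_comp (τ := fun j => σs (k1 (k2 j))) hg2 S hS,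
      unif_comp (τ := fun j => σs (k1 (k2 j))) hg' S hS⟩
  · intro σ
    exact ⟨(a1 σ).1, (b1 σ).1, (a1 σ).2, (b1 σ).2⟩
  · refine ⟨max Cu Cv, fun σ => ⟨?_, ?_⟩⟩
    · rw [abs_of_nonneg (a3 σ)]; exact (a4 σ).trans (le_max_left _ _)
    · rw [abs_of_nonneg (b3 σ)]; exact (b4 σ).trans (le_max_right _ _)
  · exact fun σ => ⟨a3 σ, b3 σ⟩
  · intro ξ hξ hξs hξ0
    exact ⟨dist_ineq a2 (b2.rpow_const fun _ => Or.inr (by linarith)) a5 hξ hξs hξ0,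
      dist_ineq b2 (a2.rpow_const fun _ => Or.inr (by linarith)) b5 hξ hξs hξ0⟩
end

section
/- Local interdependence of components for the system of ordinary differential inequalities: let I ⊂ ℝ be an open interval containing 0 and let φ, ψ : I → [0,∞) be continuous functions satisfying, in the sense of distributions on I, φ' + αφ ≥ c₁ψ^p and ψ' + βψ ≥ c₁φ^q; i.e. for every nonnegative ξ ∈ C_c^∞(I), ∫_I (−φξ' + αφξ) dσ ≥ c₁∫_I ψ^p ξ dσ and ∫_I (−ψξ' + βψξ) dσ ≥ c₁∫_I φ^q ξ dσ. Then φ(0) = 0 if and only if ψ(0) = 0. -/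
open Set Filter MeasureTheory

theorem ODI_aux
    (p c₁ α : ℝ) (hp : 1 < p) (hc₁ : 0 < c₁)
    (I : Set ℝ) (hIopen : IsOpen I) (hI0 : (0:ℝ) ∈ I)
    (φ ψ : ℝ → ℝ)
    (hφc : ContinuousOn φ I) (hψc : ContinuousOn ψ I)
    (hφnn : ∀ x ∈ I, 0 ≤ φ x) (hψnn : ∀ x ∈ I, 0 ≤ ψ x)
    (h1 : ∀ ξ : ℝ → ℝ, ContDiff ℝ (⊤ : ℕ∞) ξ → HasCompactSupport ξ →
      tsupport ξ ⊆ I → (∀ x, 0 ≤ ξ x) →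
      c₁ * ∫ σ in I, ψ σ ^ p * ξ σ
          ≤ ∫ σ in I, (-(φ σ) * deriv ξ σ + α * φ σ * ξ σ))
    (h0 : φ 0 = 0) : ψ 0 = 0 := by
  by_contra hne
  have hψ0 : 0 < ψ 0 := lt_of_le_of_ne (hψnn 0 hI0) (Ne.symm hne)
  have hnhds : I ∈ nhds (0:ℝ) := hIopen.mem_nhds hI0
  have hp0 : 0 ≤ p := by linarith
  have hφa : ContinuousAt φ 0 := hφc.continuousAt hnhds
  have hψa : ContinuousAt ψ 0 := hψc.continuousAt hnhds
  have hga : ContinuousAt (fun x => ψ x ^ p * Real.exp (α * x)) 0 :=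
    (hψa.rpow_const (Or.inr hp0)).mul (by fun_prop)
  have hfa : ContinuousAt (fun x => φ x * Real.exp (α * x)) 0 :=
    hφa.mul (by fun_prop)
  obtain ⟨m, hm, hmlt⟩ : ∃ m : ℝ, 0 < m ∧ m < ψ 0 ^ p * Real.exp (α * 0) :=
    exists_between (by positivity)
  have hev : ∀ᶠ x in nhds (0:ℝ), m < ψ x ^ p * Real.exp (α * x) ∧ x ∈ I :=
    (hga.eventually (lt_mem_nhds hmlt)).and hnhds
  obtain ⟨r, hr, hrb⟩ := Metric.eventually_nhds_iff.1 hev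
  obtain ⟨d, hd, hdr⟩ : ∃ d : ℝ, 0 < d ∧ 2 * d < r := ⟨r/4, by linarith, by linarith⟩
  have hK : ∀ x ∈ Icc (-(2*d)) 0, m < ψ x ^ p * Real.exp (α * x) ∧ x ∈ I := by
    intro x hx
    apply hrb
    rw [Real.dist_eq, sub_zero, abs_lt]
    constructor <;> linarith [hx.1, hx.2]
  set κ : ℝ := c₁ * m * d / 4 with hκ
  have hκ0 : 0 < κ := by positivity
  have hev2 : ∀ᶠ x in nhds (0:ℝ), φ x * Real.exp (α * x) < κ :=
    hfa.eventually (gt_mem_nhds (by simpa [h0] using hκ0))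
  obtain ⟨s, hs, hsb⟩ := Metric.eventually_nhds_iff.1 hev2
  obtain ⟨ε, hε, hεs, hεd⟩ : ∃ ε : ℝ, 0 < ε ∧ ε < s ∧ ε ≤ d / 2 :=
    ⟨min (s/2) (d/2), by positivity, lt_of_le_of_lt (min_le_left _ _) (by linarith),
      min_le_right _ _⟩
  have hF : ∀ x ∈ Icc (-ε) 0, φ x * Real.exp (α * x) ≤ κ := by
    intro x hx
    apply le_of_lt
    apply hsb
    rw [Real.dist_eq, sub_zero, abs_lt]
    constructor <;> linarith [hx.1, hx.2]
  set A : ℝ → ℝ := fun x => Real.smoothTransition ((x + 2*d)/d) with hA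
  set B : ℝ → ℝ := fun x => Real.smoothTransition (-x/ε) with hB
  have hAs : ContDiff ℝ (⊤ : ℕ∞) A := Real.smoothTransition.contDiff.comp (by fun_prop)
  have hBs : ContDiff ℝ (⊤ : ℕ∞) B := Real.smoothTransition.contDiff.comp (by fun_prop)
  have hAm : Monotone A := fun x y hxy => Real.smoothTransition.monotone (by gcongr)
  have hBm : Antitone B := fun x y hxy => Real.smoothTransition.monotone (by gcongr)
  have hA0 : ∀ x, 0 ≤ A x := fun x => Real.smoothTransition.nonneg _
  have hB0 : ∀ x, 0 ≤ B x := fun x => Real.smoothTransition.nonneg _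
  have hA1 : ∀ x, A x ≤ 1 := fun x => Real.smoothTransition.le_one _
  have hAd : ∀ x, 0 ≤ deriv A x := fun x => hAm.deriv_nonneg
  have hBd : ∀ x, deriv B x ≤ 0 := fun x => hBm.deriv_nonpos
  have hAone : ∀ x, -d ≤ x → A x = 1 := fun x hx =>
    Real.smoothTransition.one_of_one_le (by rw [le_div_iff₀ hd]; linarith)
  have hBone : ∀ x, x ≤ -ε → B x = 1 := fun x hx =>
    Real.smoothTransition.one_of_one_le (by rw [le_div_iff₀ hε]; linarith)
  have hAz : ∀ x, x ≤ -(2*d) → A x = 0 := fun x hx =>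
    Real.smoothTransition.zero_of_nonpos (div_nonpos_of_nonpos_of_nonneg (by linarith) hd.le)
  have hBz : ∀ x, 0 ≤ x → B x = 0 := fun x hx =>
    Real.smoothTransition.zero_of_nonpos (div_nonpos_of_nonpos_of_nonneg (by linarith) hε.le)
  have hBdz : ∀ x, x < -ε → deriv B x = 0 := by
    intro x hx
    have : B =ᶠ[nhds x] fun _ => (1:ℝ) := by
      filter_upwards [Iio_mem_nhds hx] with y hy using hBone y (le_of_lt hy)
    rw [this.deriv_eq]; simp
  set ξ : ℝ → ℝ := fun x => Real.exp (α * x) * (A x * B x) with hξ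
  have hξs : ContDiff ℝ (⊤ : ℕ∞) ξ := by
    apply ContDiff.mul _ (hAs.mul hBs)
    exact Real.contDiff_exp.comp (by fun_prop)
  have hξ0 : ∀ x, 0 ≤ ξ x := fun x => mul_nonneg (Real.exp_pos _).le (mul_nonneg (hA0 x) (hB0 x))
  have hξz : ∀ x, x ∉ Icc (-(2*d)) 0 → ξ x = 0 := by
    intro x hx
    by_cases h : x ≤ -(2*d)
    · simp [hξ, hAz x h]
    · have : 0 ≤ x := by
        by_contra h'
        exact hx ⟨by linarith, by linarith⟩
      simp [hξ, hBz x this]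
  have hts : tsupport ξ ⊆ Icc (-(2*d)) 0 := by
    apply closure_minimal _ isClosed_Icc
    intro x hx
    by_contra h
    exact hx (hξz x h)
  have hKI : Icc (-(2*d)) 0 ⊆ I := fun x hx => (hK x hx).2
  have hmain := h1 ξ hξs (HasCompactSupport.of_support_subset_isCompact isCompact_Icc
    ((subset_tsupport ξ).trans hts)) (hts.trans hKI) hξ0
  have hξdz : ∀ x, x ∉ Icc (-(2*d)) 0 → deriv ξ x = 0 := fun x hx =>
    deriv_of_notMem_tsupport (fun h => hx (hts h))
  have e1 : ∫ σ in I, ψ σ ^ p * ξ σ = ∫ σ in Icc (-(2*d)) 0, ψ σ ^ p * ξ σ :=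
    setIntegral_eq_of_subset_of_forall_sdiff_eq_zero hIopen.measurableSet hKI
      (fun x hx => by simp [hξz x hx.2])
  have e2 : ∫ σ in I, (-(φ σ) * deriv ξ σ + α * φ σ * ξ σ)
      = ∫ σ in Icc (-(2*d)) 0, (-(φ σ) * deriv ξ σ + α * φ σ * ξ σ) :=
    setIntegral_eq_of_subset_of_forall_sdiff_eq_zero hIopen.measurableSet hKI
      (fun x hx => by simp [hξz x hx.2, hξdz x hx.2])
  rw [e1, e2] at hmain
  have hξc : Continuous ξ := hξs.continuous
  have hξdc : Continuous (deriv ξ) := hξs.continuous_deriv (by simp)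
  have hBdc : Continuous (deriv B) := hBs.continuous_deriv (by simp)
  have hφK := hφc.mono hKI
  have hψK := hψc.mono hKI
  have c1 : ContinuousOn (fun σ => ψ σ ^ p * ξ σ) (Icc (-(2*d)) 0) :=
    (hψK.rpow_const (fun x _ => Or.inr hp0)).mul hξc.continuousOn
  have c2 : ContinuousOn (fun σ => -(φ σ) * deriv ξ σ + α * φ σ * ξ σ) (Icc (-(2*d)) 0) :=
    (hφK.neg.mul hξdc.continuousOn).add ((continuousOn_const.mul hφK).mul hξc.continuousOn)
  have i1 := c1.integrableOn_compact (μ := volume) isCompact_Icc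
  have i2 := c2.integrableOn_compact (μ := volume) isCompact_Icc
  have hub : ∫ σ in Icc (-(2*d)) 0, (-(φ σ) * deriv ξ σ + α * φ σ * ξ σ) ≤ κ := by
    have hle : ∫ σ in Icc (-(2*d)) 0, (-(φ σ) * deriv ξ σ + α * φ σ * ξ σ)
        ≤ ∫ σ in Icc (-(2*d)) 0, (-κ) * deriv B σ := by
      apply setIntegral_mono_on i2 _ measurableSet_Icc
      · intro x hx
        have hAx : HasDerivAt A (deriv A x) x :=
          (hAs.differentiable (by simp) x).hasDerivAt
        have hBx : HasDerivAt B (deriv B x) x :=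
          (hBs.differentiable (by simp) x).hasDerivAt
        have hE : HasDerivAt (fun y => Real.exp (α * y)) (Real.exp (α * x) * α) x := by
          simpa using ((hasDerivAt_id x).const_mul α).exp
        have hd1 : deriv ξ x = Real.exp (α * x) * α * (A x * B x)
            + Real.exp (α * x) * (deriv A x * B x + A x * deriv B x) :=
          (hE.mul (hAx.mul hBx)).deriv
        have hf0 : 0 ≤ φ x * Real.exp (α * x) :=
          mul_nonneg (hφnn x (hKI hx)) (Real.exp_pos _).le
        have heq : -(φ x) * deriv ξ x + α * φ x * ξ x
            = -(φ x * Real.exp (α * x) * (deriv A x * B x))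
              + (φ x * Real.exp (α * x)) * A x * (- deriv B x) := by
          rw [hd1]; simp only [hξ]; ring
        rw [heq]
        have t1 : 0 ≤ φ x * Real.exp (α * x) * (deriv A x * B x) :=
          mul_nonneg hf0 (mul_nonneg (hAd x) (hB0 x))
        have t2 : (φ x * Real.exp (α * x)) * A x * (- deriv B x) ≤ κ * (- deriv B x) := by
          by_cases hxe : x < -ε
          · simp [hBdz x hxe]
          · apply mul_le_mul_of_nonneg_right _ (by linarith [hBd x])
            have := hF x ⟨by linarith, hx.2⟩
            exact (mul_le_of_le_one_right hf0 (hA1 x)).trans this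
        linarith
      · exact ((continuous_const.mul hBdc).continuousOn).integrableOn_compact isCompact_Icc
    refine hle.trans (le_of_eq ?_)
    rw [integral_Icc_eq_integral_Ioc, ← intervalIntegral.integral_of_le (by linarith),
      intervalIntegral.integral_const_mul,
      intervalIntegral.integral_deriv_eq_sub
        (fun x _ => hBs.differentiable (by simp) x) (hBdc.intervalIntegrable _ _),
      hBz 0 le_rfl, hBone _ (by linarith)]
    ring
  have hlb : m * (d/2) ≤ ∫ σ in Icc (-(2*d)) 0, ψ σ ^ p * ξ σ := by
    have hsub : Icc (-d) (-(d/2)) ⊆ Icc (-(2*d)) 0 :=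
      Icc_subset_Icc (by linarith) (by linarith)
    have s1 : ∫ σ in Icc (-d) (-(d/2)), ψ σ ^ p * ξ σ ≤
        ∫ σ in Icc (-(2*d)) 0, ψ σ ^ p * ξ σ := by
      apply setIntegral_mono_set i1 _ hsub.eventuallyLE
      apply (ae_restrict_iff' measurableSet_Icc).2 (ae_of_all _ _)
      intro x hx
      exact mul_nonneg (Real.rpow_nonneg (hψnn x (hKI hx)) _) (hξ0 x)
    have s2 : ∫ σ in Icc (-d) (-(d/2)), m ≤ ∫ σ in Icc (-d) (-(d/2)), ψ σ ^ p * ξ σ := by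
      apply setIntegral_mono_on _ (i1.mono_set hsub) measurableSet_Icc
      · intro x hx
        have := (hK x (hsub hx)).1
        simp only [hξ]
        rw [hAone x hx.1, hBone x (by linarith [hx.2])]
        simpa using this.le
      · exact continuousOn_const.integrableOn_compact isCompact_Icc
    refine le_trans (le_of_eq ?_) (s2.trans s1)
    rw [setIntegral_const, Real.volume_real_Icc_of_le (by linarith), smul_eq_mul]
    ring
  have : c₁ * (m * (d/2)) ≤ κ := (mul_le_mul_of_nonneg_left hlb hc₁.le).trans (hmain.trans hub)
  have hpos : 0 < c₁ * m * d := by positivity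
  rw [hκ] at this
  linarith

/-- Local interdependence of components for the system of ordinary differential
inequalities `φ' + αφ ≥ c₁ψ^p`, `ψ' + βψ ≥ c₁φ^q` (in the sense of distributions)
on an open interval `I` containing `0`, for continuous nonnegative `φ, ψ`:
`φ(0) = 0` if and only if `ψ(0) = 0`. -/
theorem ODI_local_interdependence
    (p q c₁ α β : ℝ) (hp : 1 < p) (hq : 1 < q) (hc₁ : 0 < c₁)
    (hα : 0 < α) (hβ : 0 < β)
    (I : Set ℝ) (hIopen : IsOpen I) (hIconn : I.OrdConnected) (hI0 : (0:ℝ) ∈ I)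
    (φ ψ : ℝ → ℝ)
    (hφc : ContinuousOn φ I) (hψc : ContinuousOn ψ I)
    (hφnn : ∀ x ∈ I, 0 ≤ φ x) (hψnn : ∀ x ∈ I, 0 ≤ ψ x)
    (h1 : ∀ ξ : ℝ → ℝ, ContDiff ℝ (⊤ : ℕ∞) ξ → HasCompactSupport ξ →
      tsupport ξ ⊆ I → (∀ x, 0 ≤ ξ x) →
      c₁ * ∫ σ in I, ψ σ ^ p * ξ σ
          ≤ ∫ σ in I, (-(φ σ) * deriv ξ σ + α * φ σ * ξ σ))
    (h2 : ∀ ξ : ℝ → ℝ, ContDiff ℝ (⊤ : ℕ∞) ξ → HasCompactSupport ξ →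
      tsupport ξ ⊆ I → (∀ x, 0 ≤ ξ x) →
      c₁ * ∫ σ in I, φ σ ^ q * ξ σ
          ≤ ∫ σ in I, (-(ψ σ) * deriv ξ σ + β * ψ σ * ξ σ)) :
    (φ 0 = 0 ↔ ψ 0 = 0) := by
  exact ⟨ODI_aux p c₁ α hp hc₁ I hIopen hI0 φ ψ hφc hψc hφnn hψnn h1,
    ODI_aux q c₁ β hq hc₁ I hIopen hI0 ψ φ hψc hφc hψnn hφnn h2⟩
end

section
/- Superlinearity of the oscillating nonlinearity: let p > 1, λ > 0 and 0 < k < (p−1)√(1+λ)/λ, and define F(v) = v^p·(1 + λ sin²(k·log(1+v))) for v ≥ 0. Then there exists η > 0 such that v·F'(v) ≥ (1+η)·F(v) for all v ≥ 0, where F'(v) = p v^{p−1}(1 + λ sin²(k log(1+v))) + v^p · 2λk (sin(k log(1+v)) cos(k log(1+v)))/(1+v). -/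
/-- Superlinearity of the oscillating nonlinearity
`F(v) = v^p (1 + λ sin²(k log(1+v)))`: if `p > 1`, `λ > 0` and
`0 < k < (p-1)√(1+λ)/λ`, then there is `η > 0` with `v F'(v) ≥ (1+η) F(v)`
for all `v ≥ 0`. -/
theorem oscillating_nonlinearity_superlinear
    (p lam k : ℝ) (hp : 1 < p) (hlam : 0 < lam)
    (hk0 : 0 < k) (hk : k < (p - 1) * Real.sqrt (1 + lam) / lam) :
    ∃ η > (0:ℝ), ∀ v : ℝ, 0 ≤ v →
      (1 + η) * (v ^ p * (1 + lam * Real.sin (k * Real.log (1 + v)) ^ 2))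
        ≤ v * (p * v ^ (p - 1) * (1 + lam * Real.sin (k * Real.log (1 + v)) ^ 2)
            + v ^ p * (2 * lam * k *
                (Real.sin (k * Real.log (1 + v)) * Real.cos (k * Real.log (1 + v)))
                  / (1 + v))) := by
  obtain ⟨r, hr⟩ : ∃ r, r = Real.sqrt (1 + lam) := ⟨_, rfl⟩
  have hr0 : 0 < r := by rw [hr]; exact Real.sqrt_pos.mpr (by linarith)
  have hr2 : r ^ 2 = 1 + lam := by rw [hr]; exact Real.sq_sqrt (by linarith)
  rw [← hr] at hk
  have hk' : k * lam / r < p - 1 := by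
    rw [lt_div_iff₀ hlam] at hk
    rw [div_lt_iff₀ hr0]; exact hk
  refine ⟨p - 1 - k * lam / r, by linarith, ?_⟩
  intro v hv
  have hsc := Real.sin_sq_add_cos_sq (k * Real.log (1 + v))
  generalize Real.sin (k * Real.log (1 + v)) = s at *
  generalize Real.cos (k * Real.log (1 + v)) = c at *
  have hvp : v * v ^ (p - 1) = v ^ p := by
    rcases hv.eq_or_lt with h | h
    · rw [← h, Real.zero_rpow (by linarith : p ≠ 0)]; simp
    · rw [Real.rpow_sub_one h.ne']; field_simp
  have hP : 0 ≤ v ^ p := Real.rpow_nonneg hv p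
  have hA : 2 * r * |s * c| ≤ 1 + lam * s ^ 2 := by
    have h1 : 1 + lam * s ^ 2 = c ^ 2 + (r * s) ^ 2 := by
      rw [mul_pow, hr2]; linarith
    rw [h1]
    have : 2 * r * |s * c| = 2 * (r * |s|) * |c| := by rw [abs_mul]; ring
    rw [this, mul_pow, ← sq_abs c, ← sq_abs s]
    nlinarith [sq_nonneg (r * |s| - |c|)]
  have ht0 : 0 ≤ v / (1 + v) := by positivity
  have ht1 : v / (1 + v) ≤ 1 := by rw [div_le_one (by linarith)]; linarith
  have hq : 2 * (k * lam) * |s * c| ≤ k * lam / r * (1 + lam * s ^ 2) := by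
    calc 2 * (k * lam) * |s * c| = k * lam / r * (2 * r * |s * c|) := by field_simp
      _ ≤ _ := by gcongr
  have ht : -|s * c| ≤ v / (1 + v) * (s * c) := by
    have h1 := neg_abs_le (s * c)
    have h2 := abs_nonneg (s * c)
    nlinarith [mul_le_mul_of_nonneg_left h1 ht0, mul_le_mul_of_nonneg_right ht1 h2]
  have hkl : 0 < k * lam := by positivity
  have key : 0 ≤ k * lam / r * (1 + lam * s ^ 2) + 2 * (k * lam) * (v / (1 + v) * (s * c)) := by
    nlinarith [mul_le_mul_of_nonneg_left ht hkl.le]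
  have fin := mul_nonneg hP key
  have e : v * (p * v ^ (p - 1) * (1 + lam * s ^ 2) + v ^ p * (2 * lam * k * (s * c) / (1 + v)))
      = p * (v * v ^ (p - 1)) * (1 + lam * s ^ 2)
        + v ^ p * (2 * (k * lam) * (v / (1 + v) * (s * c))) := by ring
  rw [e, hvp]
  linarith
end

section
/- Verification of the structure condition (H) for sums of power nonlinearities: let m ≥ 1, p, q > 1, λ, λ̄ > 0, and for 1 ≤ i ≤ m let λ_i, λ̄_i ≥ 0 and r_i, s_i, r̄_i, s̄_i ≥ 0 satisfy r_i·(p+1)/(q+1) + s_i ≤ p and r̄_i + s̄_i·(p+1)/(q+1) ≤ q. Define, for u, v > 0, F(u,v) = λv^p + Σ_{i=1}^m λ_i u^{r_i} v^{s_i} and G(u,v) = λ̄u^q + Σ_{i=1}^m λ̄_i u^{r̄_i} v^{s̄_i}, so that u·F_u + κ₁·v·F_v = κ₁λp v^p + Σ_i λ_i(r_i + κ₁ s_i) u^{r_i} v^{s_i} and v·G_v + κ₂·u·G_u = κ₂λ̄q u^q + Σ_i λ̄_i(κ₂ r̄_i + s̄_i) u^{r̄_i} v^{s̄_i}. Then for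 all C₁, C₂ with 0 < C₁ ≤ C₂ there exist μ > 0, A > 0 and κ₁ ∈ (1/p, 1), κ₂ ∈ (1/q, 1) (so that κ₁κ₂ < 1) such that (1+μ)F(u,v) ≤ u·F_u(u,v) + κ₁·v·F_v(u,v) and (1+μ)G(u,v) ≤ v·G_v(u,v) + κ₂·u·G_u(u,v) for all (u,v) with u ≥ A, v ≥ A and C₁ ≤ u^{q+1}/v^{p+1} ≤ C₂. -/
open Finset

open Filter Topology in
lemma aux_asymp (p q C M η : ℝ) (hp : 1 < p) (hq : 1 < q) (hC : 0 < C) (hM : 0 ≤ M) (hη : 0 < η) :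
    ∃ A : ℝ, 1 ≤ A ∧ ∀ u v : ℝ, 1 ≤ u → A ≤ v → u ^ (q + 1) ≤ C * v ^ (p + 1) →
      M * (u + v) ≤ η * v ^ p := by
  set a := (p + 1) / (q + 1) with ha
  have hap : a < p := by
    rw [ha, div_lt_iff₀ (by linarith)]; nlinarith
  have h1 : Tendsto (fun v : ℝ => v ^ (-(p - a))) atTop (𝓝 0) :=
    tendsto_rpow_neg_atTop (by linarith)
  have h2 : Tendsto (fun v : ℝ => v ^ (-(p - 1))) atTop (𝓝 0) :=
    tendsto_rpow_neg_atTop (by linarith)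
  set K := C ^ (1 / (q + 1)) with hK
  have h3 : Tendsto (fun v : ℝ => M * (K * v ^ (-(p - a)) + v ^ (-(p - 1)))) atTop (𝓝 0) := by
    have := ((h1.const_mul K).add h2).const_mul M
    simpa using this
  have h4 := h3.eventually (gt_mem_nhds hη)
  obtain ⟨A, hA⟩ := eventually_atTop.1 h4
  refine ⟨max A 1, le_max_right _ _, fun u v hu hv huv => ?_⟩
  have hv1 : 1 ≤ v := le_trans (le_max_right _ _) hv
  have hv0 : 0 < v := by linarith
  have hu0 : 0 < u := by linarith
  have h5 := hA v (le_trans (le_max_left _ _) hv)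
  have h6 : u ≤ K * v ^ a := by
    have h := Real.rpow_le_rpow (by positivity) huv (show 0 ≤ 1 / (q + 1) by positivity)
    rw [← Real.rpow_mul hu0.le, Real.mul_rpow hC.le (by positivity), ← Real.rpow_mul hv0.le] at h
    have e : (q + 1) * (1 / (q + 1)) = 1 := by field_simp
    have e2 : (p + 1) * (1 / (q + 1)) = a := by rw [ha]; ring
    rwa [e, e2, Real.rpow_one] at h
  have e1 : v ^ (-(p - a)) * v ^ p = v ^ a := by
    rw [← Real.rpow_add hv0]; congr 1; ring
  have e2 : v ^ (-(p - 1)) * v ^ p = v := by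
    rw [← Real.rpow_add hv0]
    conv_rhs => rw [← Real.rpow_one v]
    congr 1; ring
  calc M * (u + v) ≤ M * (K * v ^ a + v) := by gcongr
    _ = M * (K * v ^ (-(p - a)) + v ^ (-(p - 1))) * v ^ p := by
      rw [mul_assoc, add_mul, mul_assoc, e1, e2]
    _ ≤ η * v ^ p := by gcongr

lemma aux_term (u v r s : ℝ) (hu : 1 ≤ u) (hv : 1 ≤ v) (hr : 0 ≤ r) (hs : 0 ≤ s)
    (h : r + s ≤ 1) : u ^ r * v ^ s ≤ u + v := by
  have hw : 1 ≤ max u v := le_trans hu (le_max_left _ _)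
  have hw0 : 0 < max u v := by linarith
  calc u ^ r * v ^ s ≤ (max u v) ^ r * (max u v) ^ s := by
        gcongr
        · exact le_max_left _ _
        · exact le_max_right _ _
    _ = (max u v) ^ (r + s) := (Real.rpow_add hw0 _ _).symm
    _ ≤ (max u v) ^ (1:ℝ) := Real.rpow_le_rpow_of_exponent_le hw h
    _ = max u v := Real.rpow_one _
    _ ≤ u + v := max_le (by linarith) (by linarith)

lemma aux_alg {m : ℕ} (ε lam k X S : ℝ) (hε : 0 < ε) (hlam : 0 < lam) (hX : 0 ≤ X) (hS : 0 ≤ S)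
    (l c T : Fin m → ℝ) (hl : ∀ i, 0 ≤ l i) (hc : ∀ i, 0 ≤ c i) (hT : ∀ i, 0 ≤ T i)
    (hk : 1 + ε + ε ≤ k) (h : ∀ i, 1 + ε ≤ c i ∨ T i ≤ S)
    (hb : ((1 + ε) * ∑ i, l i) * S ≤ ε * lam * X) :
    (1 + ε) * (lam * X + ∑ i, l i * T i) ≤ k * lam * X + ∑ i, l i * c i * T i := by
  have h1 : (1 + ε) * ∑ i, l i * T i ≤ ((1 + ε) * ∑ i, l i) * S + ∑ i, l i * c i * T i := by
    rw [Finset.mul_sum, Finset.mul_sum, Finset.sum_mul, ← Finset.sum_add_distrib]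
    refine Finset.sum_le_sum fun i _ => ?_
    have hli := hl i
    have hci := hc i
    have hTi := hT i
    rcases h i with h | h
    · have : l i * T i * (1 + ε) ≤ l i * T i * c i := by gcongr
      have : 0 ≤ (1 + ε) * l i * S := by positivity
      linarith
    · have : (1 + ε) * l i * T i ≤ (1 + ε) * l i * S := by gcongr
      have : 0 ≤ l i * c i * T i := by positivity
      linarith
  have h2 : (1 + ε + ε) * (lam * X) ≤ k * (lam * X) := by gcongr
  linarith

open Filter Topology in
lemma aux_lin (r s t : ℝ) (h : 1 < r + s) :
    ∀ᶠ ε in 𝓝[>] (0:ℝ), 1 + ε + t * ε ≤ r + (1 - ε) * s := by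
  have hc : ContinuousAt (fun ε : ℝ => r + (1 - ε) * s - (1 + ε + t * ε)) 0 := by fun_prop
  have : ∀ᶠ ε in 𝓝 (0:ℝ), 0 < r + (1 - ε) * s - (1 + ε + t * ε) := by
    apply hc.eventually (lt_mem_nhds _)
    simp; linarith
  filter_upwards [nhdsWithin_le_nhds this] with ε h
  linarith

/-- Verification of the structure condition (H) for sums of power nonlinearities
`F(u,v) = λ v^p + Σᵢ λᵢ u^{rᵢ} v^{sᵢ}`, `G(u,v) = λ̄ u^q + Σᵢ λ̄ᵢ u^{r̄ᵢ} v^{s̄ᵢ}`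
with `rᵢ (p+1)/(q+1) + sᵢ ≤ p` and `r̄ᵢ + s̄ᵢ (p+1)/(q+1) ≤ q`: for every
`0 < C₁ ≤ C₂` there are `μ, A > 0` and `κ₁ ∈ (1/p, 1)`, `κ₂ ∈ (1/q, 1)` such that
`(1+μ) F ≤ u F_u + κ₁ v F_v` and `(1+μ) G ≤ v G_v + κ₂ u G_u` on the set
`{u, v ≥ A, C₁ ≤ u^{q+1}/v^{p+1} ≤ C₂}`. -/
theorem structure_condition_for_power_sums
    (m : ℕ) (hm : 1 ≤ m) (p q lam lam' : ℝ)
    (hp : 1 < p) (hq : 1 < q) (hlam : 0 < lam) (hlam' : 0 < lam')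
    (lami lami' ri si ri' si' : Fin m → ℝ)
    (hlami : ∀ i, 0 ≤ lami i) (hlami' : ∀ i, 0 ≤ lami' i)
    (hri : ∀ i, 0 ≤ ri i) (hsi : ∀ i, 0 ≤ si i)
    (hri' : ∀ i, 0 ≤ ri' i) (hsi' : ∀ i, 0 ≤ si' i)
    (hsubF : ∀ i, ri i * (p + 1) / (q + 1) + si i ≤ p)
    (hsubG : ∀ i, ri' i + si' i * (p + 1) / (q + 1) ≤ q) :
    ∀ C₁ C₂ : ℝ, 0 < C₁ → C₁ ≤ C₂ →
      ∃ μ > (0:ℝ), ∃ A > (0:ℝ), ∃ κ₁ ∈ Set.Ioo (1 / p) 1, ∃ κ₂ ∈ Set.Ioo (1 / q) 1,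
        ∀ u v : ℝ, A ≤ u → A ≤ v →
          C₁ ≤ u ^ (q + 1) / v ^ (p + 1) → u ^ (q + 1) / v ^ (p + 1) ≤ C₂ →
          (1 + μ) * (lam * v ^ p + ∑ i, lami i * u ^ ri i * v ^ si i)
              ≤ κ₁ * lam * p * v ^ p
                + ∑ i, lami i * (ri i + κ₁ * si i) * u ^ ri i * v ^ si i ∧
          (1 + μ) * (lam' * u ^ q + ∑ i, lami' i * u ^ ri' i * v ^ si' i)
              ≤ κ₂ * lam' * q * u ^ q
                + ∑ i, lami' i * (κ₂ * ri' i + si' i) * u ^ ri' i * v ^ si' i := by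
  intro C₁ C₂ hC₁ hC
  have hC₂ : 0 < C₂ := lt_of_lt_of_le hC₁ hC
  have hex : ∃ ε : ℝ, 0 < ε ∧ ε < 1 ∧ 1 + ε + 1 * ε ≤ 0 + (1 - ε) * p ∧
      1 + ε + 1 * ε ≤ 0 + (1 - ε) * q ∧
      (∀ i, 1 < ri i + si i → 1 + ε + 0 * ε ≤ ri i + (1 - ε) * si i) ∧
      (∀ i, 1 < si' i + ri' i → 1 + ε + 0 * ε ≤ si' i + (1 - ε) * ri' i) := by
    have e1 : ∀ᶠ ε in nhdsWithin (0:ℝ) (Set.Ioi 0), 0 < ε := self_mem_nhdsWithin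
    have e2 : ∀ᶠ ε in nhdsWithin (0:ℝ) (Set.Ioi 0), ε < 1 :=
      nhdsWithin_le_nhds (gt_mem_nhds one_pos)
    have e3 := aux_lin 0 p 1 (by linarith)
    have e4 := aux_lin 0 q 1 (by linarith)
    have e5 : ∀ᶠ ε in nhdsWithin (0:ℝ) (Set.Ioi 0),
        ∀ i, 1 < ri i + si i → 1 + ε + 0 * ε ≤ ri i + (1 - ε) * si i := by
      refine Filter.eventually_all.2 fun i => ?_
      by_cases h : 1 < ri i + si i
      · filter_upwards [aux_lin _ _ 0 h] with ε he _ using he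
      · exact Filter.Eventually.of_forall fun ε h' => absurd h' h
    have e6 : ∀ᶠ ε in nhdsWithin (0:ℝ) (Set.Ioi 0),
        ∀ i, 1 < si' i + ri' i → 1 + ε + 0 * ε ≤ si' i + (1 - ε) * ri' i := by
      refine Filter.eventually_all.2 fun i => ?_
      by_cases h : 1 < si' i + ri' i
      · filter_upwards [aux_lin _ _ 0 h] with ε he _ using he
      · exact Filter.Eventually.of_forall fun ε h' => absurd h' h
    exact (e1.and (e2.and (e3.and (e4.and (e5.and e6))))).exists
  obtain ⟨ε, hε, hε1, hεp, hεq, hF, hG⟩ := hex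
  have hs1 : 0 ≤ ∑ i, lami i := Finset.sum_nonneg fun i _ => hlami i
  have hs2 : 0 ≤ ∑ i, lami' i := Finset.sum_nonneg fun i _ => hlami' i
  obtain ⟨A₁, hA₁, H₁⟩ := aux_asymp p q C₂ ((1 + ε) * ∑ i, lami i) (ε * lam) hp hq hC₂
    (by positivity) (by positivity)
  obtain ⟨A₂, hA₂, H₂⟩ := aux_asymp q p C₁⁻¹ ((1 + ε) * ∑ i, lami' i) (ε * lam') hq hp
    (by positivity) (by positivity) (by positivity)
  refine ⟨ε, hε, max A₁ A₂, lt_of_lt_of_le one_pos (hA₁.trans (le_max_left _ _)), 1 - ε,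
    ⟨?_, by linarith⟩, 1 - ε, ⟨?_, by linarith⟩, ?_⟩
  · rw [div_lt_iff₀ (by linarith)]; linarith
  · rw [div_lt_iff₀ (by linarith)]; linarith
  intro u v hu hv hl hr
  have hu1 := (le_max_left _ _).trans hu
  have hu2 := (le_max_right _ _).trans hu
  have hv1 := (le_max_left _ _).trans hv
  have hv2 := (le_max_right _ _).trans hv
  have u1 : 1 ≤ u := hA₁.trans hu1
  have v1 : 1 ≤ v := hA₁.trans hv1
  have u0 : 0 < u := by linarith
  have v0 : 0 < v := by linarith
  have hvp : 0 < v ^ (p + 1) := by positivity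
  have k1 := H₁ u v u1 hv1 ((div_le_iff₀ hvp).1 hr)
  have k2 := H₂ v u v1 hu2 (by
    rw [le_div_iff₀ hvp] at hl
    rw [inv_mul_eq_div, le_div_iff₀ hC₁]; linarith)
  have ε0 : 0 ≤ 1 - ε := by linarith
  constructor
  · have := aux_alg ε lam ((1 - ε) * p) (v ^ p) (u + v) hε hlam (by positivity) (by positivity)
      lami (fun i => ri i + (1 - ε) * si i) (fun i => u ^ ri i * v ^ si i) hlami
      (fun i => add_nonneg (hri i) (mul_nonneg ε0 (hsi i))) (fun i => by positivity)
      (by linarith) (fun i => ?_) k1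
    · convert this using 2
      · simp only [mul_assoc]
      · ring
      · simp only [mul_assoc]
    · rcases lt_or_ge 1 (ri i + si i) with h | h
      · left; linarith [hF i h]
      · right; exact aux_term u v _ _ u1 v1 (hri i) (hsi i) h
  · have := aux_alg ε lam' ((1 - ε) * q) (u ^ q) (v + u) hε hlam' (by positivity) (by positivity)
      lami' (fun i => (1 - ε) * ri' i + si' i) (fun i => u ^ ri' i * v ^ si' i) hlami'
      (fun i => add_nonneg (mul_nonneg ε0 (hri' i)) (hsi' i)) (fun i => by positivity)
      (by linarith) (fun i => ?_) k2
    · convert this using 2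
      · simp only [mul_assoc]
      · ring
      · simp only [mul_assoc]
    · rcases lt_or_ge 1 (si' i + ri' i) with h | h
      · left; linarith [hG i h]
      · right
        have := aux_term u v _ _ u1 v1 (hri' i) (hsi' i) (by linarith)
        linarith
end

section
/- Young-type inequality for mixed power terms subcritical with respect to the blow-up scaling: let p, q > 1 and let r, s ≥ 0 satisfy r·(p+1)/(q+1) + s ≤ p. Then there exists a constant C > 0 such that u^r v^s ≤ u^{p(q+1)/(p+1)} + C(v^p + 1) for all u, v ≥ 0. -/
/-- Young-type inequality for mixed power terms subcritical with respect to the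
blow-up scaling: if `p, q > 1` and `r, s ≥ 0` satisfy `r (p+1)/(q+1) + s ≤ p`,
then there is `C > 0` with `u^r v^s ≤ u^{p(q+1)/(p+1)} + C (v^p + 1)` for all
`u, v ≥ 0` (real powers, with `0^0 = 1`). -/
theorem young_type_mixed_power_inequality
    (p q r s : ℝ) (hp : 1 < p) (hq : 1 < q)
    (hr : 0 ≤ r) (hs : 0 ≤ s) (hsub : r * (p + 1) / (q + 1) + s ≤ p) :
    ∃ C > (0:ℝ), ∀ u v : ℝ, 0 ≤ u → 0 ≤ v →
      u ^ r * v ^ s ≤ u ^ (p * (q + 1) / (p + 1)) + C * (v ^ p + 1) := by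
  have hm : 0 < p * (q + 1) / (p + 1) := by positivity
  have hp0 : 0 < p := by linarith
  have hq0 : 0 < q + 1 := by linarith
  set m := p * (q + 1) / (p + 1) with hmdef
  have ha : 0 ≤ r / m := by positivity
  have hb : 0 ≤ s / p := by positivity
  have hab : r / m + s / p ≤ 1 := by
    have h1 : r / m + s / p = (r * (p + 1) / (q + 1) + s) / p := by
      rw [hmdef]
      field_simp
    rw [h1, div_le_one hp0]
    exact hsub
  refine ⟨1, one_pos, fun u v hu hv => ?_⟩
  have hU : 0 ≤ u ^ m := Real.rpow_nonneg hu _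
  have hV : 0 ≤ v ^ p := Real.rpow_nonneg hv _
  have key := Real.geom_mean_le_arith_mean3_weighted ha hb
    (sub_nonneg.2 hab) hU hV zero_le_one (by ring)
  rw [← Real.rpow_mul hu, ← Real.rpow_mul hv, Real.one_rpow, mul_one, mul_one,
    mul_div_cancel₀ _ hm.ne', mul_div_cancel₀ _ hp0.ne'] at key
  have h1 : r / m * u ^ m ≤ 1 * u ^ m := mul_le_mul_of_nonneg_right (by linarith) hU
  have h2 : s / p * v ^ p ≤ 1 * v ^ p := mul_le_mul_of_nonneg_right (by linarith) hV
  linarith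
end
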